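/- Assume s > d. Then there exists a family (μ^ω)_{ω∈Ω} of finite Borel measures on J_∞, with ω ↦ μ^ω([i]) measurable for every i ∈ J and with ℙ-a.s. 0 < μ^ω(J_∞) < ∞, such that for ℙ-almost every ω ∈ Ω the pushforward measure π(·,ω)_*μ^ω on ℝ^d is absolutely continuous with respect to d-dimensional Lebesgue measure. -/

import Mathlib

open MeasureTheory Filter Topology
open scoped ENNReal

noncomputable section

abbrev E (d : ℕ) : Type := EuclideanSpace ℝ (Fin d)

abbrev Od (d : ℕ) : Type := Matrix.orthogonalGroup (Fin d) ℝ

instance (d : ℕ) : MeasurableSpace (Od d) := borel _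
instance (d : ℕ) : BorelSpace (Od d) := ⟨rfl⟩

/-- The action of an orthogonal matrix on Euclidean space, as a linear map. -/
def act (d : ℕ) (Q : Od d) : E d →ₗ[ℝ] E d :=
  Matrix.toEuclideanLin (Q : Matrix (Fin d) (Fin d) ℝ)

/-- The set `J` of finite nonempty words: a word of length `k+1` is a function
`Fin (k+1) → Fin m`. -/
abbrev JW (m : ℕ) : Type := Σ k : ℕ, (Fin (k + 1) → Fin m)

noncomputable instance (m : ℕ) : DecidableEq (JW m) := fun _ _ => Classical.dec _

/-- The label space `(σ₋,σ₊) × O(d)`. -/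
abbrev Label (d : ℕ) (σm σp : ℝ) : Type := ↥(Set.Ioo σm σp) × Od d

/-- The space `Ω` of labelled trees. -/
abbrev Omega (d m : ℕ) (σm σp : ℝ) : Type := JW m → Label d σm σp

variable {d m : ℕ} {σm σp : ℝ}

/-- The similarity map `T_i^ω = r_i^ω • Q_i^ω` attached to the node `w`. -/
def Tnode (ω : Omega d m σm σp) (w : JW m) : E d →ₗ[ℝ] E d :=
  ((ω w).1 : ℝ) • act d (ω w).2

/-- The initial word `𝐢_{k+1}` (first `k+1` symbols) of an infinite word `i`. -/
def pre (i : ℕ → Fin m) (k : ℕ) : JW m := ⟨k, fun j => i j.1⟩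

/-- `cumT ω i n = T_{𝐢_1} ∘ ⋯ ∘ T_{𝐢_n}`. -/
def cumT (ω : Omega d m σm σp) (i : ℕ → Fin m) : ℕ → (E d →ₗ[ℝ] E d)
  | 0 => LinearMap.id
  | n + 1 => (cumT ω i n).comp (Tnode ω (pre i n))

/-- `cumR ω i n = 𝐫_{𝐢_n}^ω = r_{𝐢_1}^ω ⋯ r_{𝐢_n}^ω` (equal to 1 if `n = 0`). -/
def cumR (ω : Omega d m σm σp) (i : ℕ → Fin m) (n : ℕ) : ℝ :=
  ∏ k ∈ Finset.range n, ((ω (pre i k)).1 : ℝ)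

/-- `𝐫_w^ω` for a finite word `w`. -/
def wordR (ω : Omega d m σm σp) {k : ℕ} (w : Fin k → Fin m) : ℝ :=
  ∏ j : Fin k, ((ω ⟨j.1, fun t => w (Fin.castLE j.2 t)⟩).1 : ℝ)

/-- The `k`-th partial sum `a_{i_1} + T_{𝐢_1}(a_{i_2}) + ⋯ + T_{𝐢_1}∘⋯∘T_{𝐢_k}(a_{i_{k+1}})`. -/
def partialSum (a : Fin m → E d) (ω : Omega d m σm σp) (i : ℕ → Fin m) (k : ℕ) : E d :=
  ∑ n ∈ Finset.range (k + 1), cumT ω i n (a (i n))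

/-- The point `π(i, ω)`. -/
def piMap (a : Fin m → E d) (ω : Omega d m σm σp) (i : ℕ → Fin m) : E d :=
  ∑' n : ℕ, cumT ω i n (a (i n))

/-- `cumTFrom ω i p q = T_{𝐢_{p+2}} ∘ ⋯ ∘ T_{𝐢_{p+1+q}}`. -/
def cumTFrom (ω : Omega d m σm σp) (i : ℕ → Fin m) (p : ℕ) : ℕ → (E d →ₗ[ℝ] E d)
  | 0 => LinearMap.id
  | q + 1 => (cumTFrom ω i p q).comp (Tnode ω (pre i (p + 1 + q)))

/-- The random vector `x(i, ω, p)`. -/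
def xMap (a : Fin m → E d) (ω : Omega d m σm σp) (i : ℕ → Fin m) (p : ℕ) : E d :=
  ∑' q : ℕ, cumTFrom ω i p q (a (i (p + 1 + q)))

/-- The uniform probability measure on `(σ₋, σ₊)`, as a measure on `ℝ`. -/
def unif (σm σp : ℝ) : Measure ℝ :=
  (ENNReal.ofReal (σp - σm))⁻¹ • (volume.restrict (Set.Ioo σm σp))

/-- The uniform probability measure on `(σ₋, σ₊)`, as a measure on the subtype. -/
def unifSub (σm σp : ℝ) : Measure ↥(Set.Ioo σm σp) :=
  (ENNReal.ofReal (σp - σm))⁻¹ • ((volume : Measure ℝ).comap Subtype.val)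

/-- The measure `λ × θ` on the label space. -/
def labelM (σm σp : ℝ) {d : ℕ} (θ : Measure (Od d)) : Measure (Label d σm σp) :=
  (unifSub σm σp).prod θ

/-- The cylinder `[w]` of a finite word `w`. -/
def cyl {m k : ℕ} (w : Fin k → Fin m) : Set (ℕ → Fin m) := {j | ∀ t : Fin k, j t.1 = w t}

/-- The cylinder `[w]` of a node `w : JW m`. -/
def cylNode {m : ℕ} (w : JW m) : Set (ℕ → Fin m) := {j | ∀ t : Fin (w.1 + 1), j t.1 = w.2 t}

/-- The σ-algebra `𝓕_k` generated by the labels at nodes of length at most `k`. -/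
def Fk (d m : ℕ) (σm σp : ℝ) (k : ℕ) : MeasurableSpace (Omega d m σm σp) :=
  ⨆ w : {w : JW m // w.1 + 1 ≤ k}, MeasurableSpace.comap (fun ω => ω w.1) inferInstance

/-- `P` is the product measure `(λ×θ)^J`: coordinates are independent with law `λ×θ`. -/
def IsProductLaw (θ : Measure (Od d)) (P : Measure (Omega d m σm σp)) : Prop :=
  ∀ (S : Finset (JW m)) (A : JW m → Set (Label d σm σp)),
    (∀ w, MeasurableSet (A w)) →
    P {ω | ∀ w ∈ S, ω w ∈ A w} = ∏ w ∈ S, labelM σm σp θ (A w)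

/-- The uniformly random self-similar set `F(ω)`. -/
def Fset (a : Fin m → E d) (ω : Omega d m σm σp) : Set (E d) := Set.range (piMap a ω)

/-- `w` is an initial subword of `v`. -/
def isPrefix {m : ℕ} (w v : JW m) : Prop :=
  ∃ h : w.1 ≤ v.1, ∀ t : Fin (w.1 + 1), v.2 (Fin.castLE (Nat.succ_le_succ h) t) = w.2 t

end

set_option linter.all false

lemma Od_star_mul {d : ℕ} (Q : Od d) : (Q : Matrix (Fin d) (Fin d) ℝ).transpose * (Q : Matrix (Fin d) (Fin d) ℝ) = 1 := by
  exact (Matrix.mem_orthogonalGroup_iff' (Fin d) ℝ).1 Q.2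

lemma act_mul' {d : ℕ} (Q R : Od d) (x : E d) : act d (Q * R) x = act d Q (act d R x) := by
  simp [act, Matrix.toLpLin_apply, Matrix.mulVec_mulVec]

lemma norm_act {d : ℕ} (Q : Od d) (x : E d) : ‖act d Q x‖ = ‖x‖ := by
  have h : inner ℝ (act d Q x) (act d Q x) = inner ℝ x x := by
    simp only [act, EuclideanSpace.inner_eq_star_dotProduct, Matrix.toLpLin_apply, star_trivial]
    rw [Matrix.dotProduct_mulVec, ← Matrix.mulVec_transpose, Matrix.mulVec_mulVec, Od_star_mul,
      Matrix.one_mulVec]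
  rw [real_inner_self_eq_norm_sq, real_inner_self_eq_norm_sq] at h
  exact (sq_eq_sq₀ (norm_nonneg _) (norm_nonneg _)).1 h

lemma exists_act {d : ℕ} (x y : E d) (h : ‖x‖ = ‖y‖) : ∃ Q : Od d, act d Q x = y := by
  let R := (ℝ ∙ (x - y))ᗮ.reflection
  let M : Matrix (Fin d) (Fin d) ℝ := Matrix.toEuclideanLin.symm R.toLinearEquiv.toLinearMap
  have hM : Matrix.toEuclideanLin M = R.toLinearEquiv.toLinearMap := by simp [M]
  have hMM : M.transpose * M = 1 := by
    have h2 : (Matrix.toEuclideanLin M).adjoint ∘ₗ (Matrix.toEuclideanLin M) = LinearMap.id := by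
      apply LinearMap.ext; intro v
      apply ext_inner_right ℝ; intro w
      rw [LinearMap.comp_apply, LinearMap.adjoint_inner_left, hM]
      simp
    rw [← Matrix.toEuclideanLin_conjTranspose_eq_adjoint] at h2
    apply Matrix.toEuclideanLin.injective
    rw [← Matrix.conjTranspose_eq_transpose_of_trivial]
    ext v : 1
    have := congrArg (fun f => f v) h2
    simpa [Matrix.toLpLin_apply, Matrix.mulVec_mulVec] using this
  refine ⟨⟨M, (Matrix.mem_orthogonalGroup_iff' (Fin d) ℝ).2 hMM⟩, ?_⟩
  simp only [act]
  rw [hM]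
  exact Submodule.reflection_sub h

lemma continuous_act {d : ℕ} : Continuous fun p : Od d × E d => act d p.1 p.2 := by
  simp only [act, Matrix.toLpLin_apply]
  fun_prop

instance instSCTOd (d : ℕ) : SecondCountableTopology (Od d) := by
  have : SecondCountableTopology (Matrix (Fin d) (Fin d) ℝ) :=
    inferInstanceAs (SecondCountableTopology (Fin d → Fin d → ℝ))
  exact TopologicalSpace.Subtype.secondCountableTopology _

instance (d : ℕ) : MeasurableMul₂ (Od d) := ⟨by
  have : Continuous fun p : Od d × Od d => p.1 * p.2 := by
    apply Continuous.subtype_mk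
    exact (continuous_subtype_val.comp continuous_fst).mul (continuous_subtype_val.comp continuous_snd)
  exact this.measurable⟩

instance (d : ℕ) : MeasurableInv (Od d) := ⟨by
  have : Continuous fun p : Od d => p⁻¹ := by
    apply Continuous.subtype_mk
    exact continuous_subtype_val.matrix_transpose
  exact this.measurable⟩

lemma right_inv {d : ℕ} (θ : Measure (Od d)) [IsProbabilityMeasure θ] [θ.IsMulLeftInvariant] :
    θ.IsMulRightInvariant := by
  have : θ.inv = θ := by
    ext s hs
    have h1 : ∫⁻ x, ∫⁻ y, s.indicator 1 (x * y) ∂θ ∂θ.inv = θ s := by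
      have : ∀ x, ∫⁻ y, s.indicator (1 : Od d → ℝ≥0∞) (x * y) ∂θ = θ s := by
        intro x
        rw [lintegral_mul_left_eq_self (μ := θ) (fun y => s.indicator (1 : Od d → ℝ≥0∞) y) x]
        simp [hs]
      simp [this, Measure.inv, Measure.map_apply measurable_inv]
    have h2 : ∫⁻ y, ∫⁻ x, s.indicator 1 (x * y) ∂θ.inv ∂θ = θ.inv s := by
      have : ∀ y, ∫⁻ x, s.indicator (1 : Od d → ℝ≥0∞) (x * y) ∂θ.inv = θ.inv s := by
        intro x
        rw [lintegral_mul_right_eq_self (μ := θ.inv) (fun y => s.indicator (1 : Od d → ℝ≥0∞) y) x]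
        simp [hs]
      simp [this]
    rw [← h1, ← h2, lintegral_lintegral_swap]
    have := (measurable_const.indicator hs : Measurable (s.indicator (1 : Od d → ℝ≥0∞)))
    exact (this.comp (measurable_snd.mul measurable_fst)).aemeasurable
  rw [← this]; infer_instance

lemma unifSub_prob {σm σp : ℝ} (h1 : σm < σp) : IsProbabilityMeasure (unifSub σm σp) := by
  constructor
  have hB0 : ENNReal.ofReal (σp - σm) ≠ 0 := by simp; linarith
  rw [unifSub, Measure.smul_apply, comap_subtype_coe_apply measurableSet_Ioo]
  rw [Set.image_univ, Subtype.range_coe, Real.volume_Ioo, smul_eq_mul, ENNReal.inv_mul_cancel hB0 ENNReal.ofReal_ne_top]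

lemma labelM_prob {d : ℕ} {σm σp : ℝ} (h1 : σm < σp) (θ : Measure (Od d)) [IsProbabilityMeasure θ] :
    IsProbabilityMeasure (labelM σm σp θ) := by
  haveI := unifSub_prob h1
  unfold labelM; infer_instance

lemma lintegral_radial {d : ℕ} (hd : 1 ≤ d) (h : ℝ → ℝ≥0∞) (hh : Measurable h) :
    ∫⁻ x : E d, h ‖x‖ = (volume : Measure (E d)).toSphere Set.univ *
      ∫⁻ t in Set.Ioi (0 : ℝ), ENNReal.ofReal (t ^ (d - 1)) * h t := by
  have hfr : Module.finrank ℝ (E d) = d := by simp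
  haveI : Nontrivial (E d) := Module.nontrivial_of_finrank_pos (R := ℝ) (by omega)
  have h1 : ∫⁻ x : E d, h ‖x‖ = ∫⁻ x : ({(0 : E d)}ᶜ : Set (E d)), h ‖x.1‖ ∂((volume : Measure (E d)).comap Subtype.val) := by
    rw [lintegral_subtype_comap (measurableSet_singleton _).compl fun x ↦ h (‖x‖),
        restrict_compl_singleton]
  rw [h1]
  have hm : Measurable fun p : (Metric.sphere (0 : E d) 1) × (Set.Ioi (0 : ℝ)) => h p.2.1 :=
    hh.comp (measurable_subtype_coe.comp measurable_snd)
  have h2 := ((volume : Measure (E d)).measurePreserving_homeomorphUnitSphereProd).lintegral_comp hm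
  simp only [homeomorphUnitSphereProd_apply_snd_coe] at h2
  rw [h2, lintegral_prod _ hm.aemeasurable]
  simp only [lintegral_const]
  have hh' : Measurable fun y : Set.Ioi (0 : ℝ) => h y.1 := hh.comp measurable_subtype_coe
  rw [mul_comm, Measure.volumeIoiPow, lintegral_withDensity_eq_lintegral_mul _ (by fun_prop) hh']
  congr 1
  rw [hfr]
  exact lintegral_subtype_comap measurableSet_Ioi (fun t => ENNReal.ofReal (t ^ (d - 1)) * h t)

lemma act_smul_measurable {d : ℕ} {σm σp : ℝ} (x : E d) :
    Measurable fun l : Label d σm σp => (l.1 : ℝ) • act d l.2 x := by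
  have h : Continuous fun Q : Od d => act d Q x := continuous_act.comp (by fun_prop : Continuous fun Q : Od d => (Q, x))
  have h2 : Measurable fun l : Label d σm σp => act d l.2 x := h.measurable.comp measurable_snd
  exact (measurable_subtype_coe.comp measurable_fst).smul h2

lemma hit_unit {d : ℕ} (hd : 1 ≤ d) {σm σp : ℝ} (h0 : 0 < σm) (h1 : σm < σp)
    (θ : Measure (Od d)) [IsProbabilityMeasure θ] [θ.IsMulLeftInvariant] :
    ∃ C : ℝ≥0∞, C ≠ ⊤ ∧ ∀ (x y : E d) (ρ : ℝ), ‖x‖ = 1 →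
      labelM σm σp θ {l | ‖(l.1 : ℝ) • act d l.2 x - y‖ < ρ} ≤ C * volume (Metric.ball y ρ) := by
  haveI := right_inv θ
  have hfr : Module.finrank ℝ (E d) = d := by simp
  haveI : Nontrivial (E d) := Module.nontrivial_of_finrank_pos (R := ℝ) (by omega)
  set c := (volume : Measure (E d)).toSphere Set.univ with hc
  have hc0 : c ≠ 0 := by
    rw [hc, Measure.toSphere_apply_univ, hfr]
    have := (Metric.measure_ball_pos (volume : Measure (E d)) 0 one_pos).ne'
    simp [this]; omega
  have hct : c ≠ ⊤ := measure_ne_top _ _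
  set A := ENNReal.ofReal (σm ^ (d - 1)) with hA
  have hA0 : A ≠ 0 := by rw [hA]; simp; positivity
  have hB0 : ENNReal.ofReal (σp - σm) ≠ 0 := by simp; linarith
  refine ⟨(ENNReal.ofReal (σp - σm))⁻¹ * A⁻¹ * c⁻¹, ENNReal.mul_ne_top (ENNReal.mul_ne_top (ENNReal.inv_ne_top.2 hB0) (ENNReal.inv_ne_top.2 hA0)) (ENNReal.inv_ne_top.2 hc0), ?_⟩
  intro x y ρ hx
  have hms : MeasurableSet {l : Label d σm σp | ‖(l.1 : ℝ) • act d l.2 x - y‖ < ρ} :=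
    measurableSet_lt (((act_smul_measurable x).sub_const y).norm) measurable_const
  -- the averaged function
  let G : E d → ℝ≥0∞ := fun z => θ {Q | act d Q z ∈ Metric.ball y ρ}
  have hmeas2 : MeasurableSet {p : E d × Od d | act d p.2 p.1 ∈ Metric.ball y ρ} := by
    have h : Continuous fun p : E d × Od d => act d p.2 p.1 :=
      continuous_act.comp (by fun_prop : Continuous fun p : E d × Od d => (p.2, p.1))
    exact h.measurable Metric.isOpen_ball.measurableSet
  have hG : Measurable G := measurable_measure_prodMk_left hmeas2
  have hGrad : ∀ z, G z = G (‖z‖ • x) := by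
    intro z
    obtain ⟨R, hR⟩ := exists_act (‖z‖ • x) z (by simp [norm_smul, hx])
    have : {Q : Od d | act d Q z ∈ Metric.ball y ρ} = (fun Q => Q * R) ⁻¹' {Q | act d Q (‖z‖ • x) ∈ Metric.ball y ρ} := by
      ext Q
      simp only [Set.mem_setOf_eq, Set.preimage_setOf_eq, act_mul', hR]
    simp only [G]
    rw [this, measure_preimage_mul_right]
  let h : ℝ → ℝ≥0∞ := fun t => G (t • x)
  have hh : Measurable h := hG.comp (by fun_prop)
  have e1 : ∫⁻ z, G z = volume (Metric.ball y ρ) := by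
    have : ∫⁻ z, G z = ∫⁻ Q, volume {z | act d Q z ∈ Metric.ball y ρ} ∂θ := by
      exact (Measure.prod_apply hmeas2).symm.trans (Measure.prod_apply_symm hmeas2)
    rw [this]
    have h3 : ∀ Q : Od d, volume {z | act d Q z ∈ Metric.ball y ρ} = volume (Metric.ball y ρ) := by
      intro Q
      let li : E d →ₗᵢ[ℝ] E d := ⟨act d Q, norm_act Q⟩
      let le := li.toLinearIsometryEquiv rfl
      have := (le.measurePreserving).measure_preimage (Metric.isOpen_ball (x := y) (ε := ρ)).measurableSet.nullMeasurableSet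
      exact this
    simp only [h3, lintegral_const, measure_univ, mul_one]
  have e2 : ∫⁻ z, G z = c * ∫⁻ t in Set.Ioi (0 : ℝ), ENNReal.ofReal (t ^ (d - 1)) * h t := by
    rw [← lintegral_radial hd h hh]
    exact lintegral_congr fun z => hGrad z
  have e3 : labelM σm σp θ {l | ‖(l.1 : ℝ) • act d l.2 x - y‖ < ρ}
      = (ENNReal.ofReal (σp - σm))⁻¹ * ∫⁻ t in Set.Ioo σm σp, h t := by
    haveI := unifSub_prob h1
    rw [labelM, Measure.prod_apply hms, unifSub, lintegral_smul_measure, smul_eq_mul,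
      ← lintegral_subtype_comap measurableSet_Ioo]
    congr 1
    apply lintegral_congr
    intro t
    simp only [h, G]
    congr 1
    ext Q
    simp [dist_eq_norm]
  have e4 : ∫⁻ t in Set.Ioo σm σp, h t ≤ A⁻¹ * ∫⁻ t in Set.Ioi (0 : ℝ), ENNReal.ofReal (t ^ (d - 1)) * h t := by
    rw [← lintegral_const_mul _ (by fun_prop)]
    calc ∫⁻ t in Set.Ioo σm σp, h t ≤ ∫⁻ t in Set.Ioo σm σp, A⁻¹ * (ENNReal.ofReal (t ^ (d - 1)) * h t) := by
          apply setLIntegral_mono (by fun_prop)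
          intro t ht
          rw [← mul_assoc]
          have : A ≤ ENNReal.ofReal (t ^ (d - 1)) :=
            ENNReal.ofReal_le_ofReal (pow_le_pow_left₀ h0.le ht.1.le _)
          calc h t = A⁻¹ * A * h t := by rw [ENNReal.inv_mul_cancel hA0 (by simp [hA]), one_mul]
            _ ≤ _ := by gcongr
      _ ≤ _ := lintegral_mono_set (fun t ht => lt_trans h0 ht.1)
  rw [e3, ← e1, e2, mul_assoc, mul_assoc]
  gcongr
  refine e4.trans ?_
  gcongr
  rw [← mul_assoc, ENNReal.inv_mul_cancel hc0 hct, one_mul]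

lemma hit {d : ℕ} (hd : 1 ≤ d) {σm σp : ℝ} (h0 : 0 < σm) (h1 : σm < σp)
    (θ : Measure (Od d)) [IsProbabilityMeasure θ] [θ.IsMulLeftInvariant] (δ : ℝ) (hδ : 0 < δ) :
    ∃ C : ℝ≥0∞, C ≠ ⊤ ∧ ∀ (x y : E d) (ρ : ℝ), δ ≤ ‖x‖ →
      labelM σm σp θ {l | ‖(l.1 : ℝ) • act d l.2 x - y‖ < ρ} ≤ C * (ENNReal.ofReal ρ) ^ d := by
  obtain ⟨C, hC, h⟩ := hit_unit hd h0 h1 θ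
  refine ⟨C * (ENNReal.ofReal (δ⁻¹) ^ d * volume (Metric.ball (0 : E d) 1)), ?_, ?_⟩
  · have : volume (Metric.ball (0 : E d) 1) ≠ ⊤ := measure_ball_lt_top.ne
    finiteness
  intro x y ρ hx
  have hx0 : 0 < ‖x‖ := hδ.trans_le hx
  have hs : {l : Label d σm σp | ‖(l.1 : ℝ) • act d l.2 x - y‖ < ρ} =
      {l | ‖(l.1 : ℝ) • act d l.2 (‖x‖⁻¹ • x) - ‖x‖⁻¹ • y‖ < ‖x‖⁻¹ * ρ} := by
    ext l
    have : (l.1 : ℝ) • act d l.2 (‖x‖⁻¹ • x) - ‖x‖⁻¹ • y = ‖x‖⁻¹ • ((l.1 : ℝ) • act d l.2 x - y) := by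
      rw [map_smul, smul_sub, smul_comm]
    simp only [Set.mem_setOf_eq, this, norm_smul, norm_inv, norm_norm]
    rw [mul_lt_mul_iff_right₀ (by positivity)]
  rw [hs]
  refine (h _ _ _ (by simp [norm_smul, hx0.ne'])).trans ?_
  rw [mul_assoc]
  gcongr
  rcases le_or_gt ρ 0 with hρ | hρ
  · rw [Metric.ball_eq_empty.2 (mul_nonpos_of_nonneg_of_nonpos (by positivity) hρ)]; simp
  rw [Measure.addHaar_ball_of_pos _ _ (by positivity)]
  have hfr : Module.finrank ℝ (E d) = d := by simp
  rw [hfr, mul_right_comm, ← mul_pow, ← ENNReal.ofReal_mul (by positivity), ENNReal.ofReal_pow (by positivity)]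
  gcongr

section resample
variable {d m : ℕ} {σm σp : ℝ}

lemma measurable_upd (w : JW m) :
    Measurable fun p : Omega d m σm σp × Label d σm σp => Function.update p.1 w p.2 := by
  rw [measurable_pi_iff]
  intro v
  by_cases h : v = w
  · subst h; simpa using measurable_snd
  · simp only [Function.update_of_ne h]
    exact (measurable_pi_apply v).comp measurable_fst

lemma resample (h1 : σm < σp) (θ : Measure (Od d)) [IsProbabilityMeasure θ]
    (P : Measure (Omega d m σm σp)) [IsProbabilityMeasure P] (hP : IsProductLaw θ P) (w : JW m) :
    MeasurePreserving (fun p : Omega d m σm σp × Label d σm σp => Function.update p.1 w p.2)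
      (P.prod (labelM σm σp θ)) P := by
  haveI := labelM_prob h1 θ
  refine ⟨measurable_upd w, ?_⟩
  have e1 : P = Measure.infinitePi (fun _ => labelM σm σp θ) := by
    apply Measure.eq_infinitePi
    intro S t ht
    exact hP S t ht
  refine Eq.trans ?_ e1.symm
  apply Measure.eq_infinitePi
  intro S t ht
  rw [Measure.map_apply (measurable_upd w) (MeasurableSet.pi S.countable_toSet (fun i _ => ht i))]
  by_cases hw : w ∈ S
  · have : (fun p : Omega d m σm σp × Label d σm σp => Function.update p.1 w p.2) ⁻¹' (Set.pi S t)
        = {ω | ∀ v ∈ S.erase w, ω v ∈ t v} ×ˢ (t w) := by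
      ext ⟨ω, l⟩
      simp only [Set.mem_preimage, Set.mem_pi, Set.mem_prod, Set.mem_setOf_eq, Finset.mem_coe, Finset.mem_erase]
      constructor
      · intro h
        refine ⟨fun v hv => ?_, ?_⟩
        · have := h v hv.2
          rwa [Function.update_of_ne hv.1] at this
        · have := h w hw
          rwa [Function.update_self] at this
      · rintro ⟨h, h'⟩ v hv
        by_cases hvw : v = w
        · subst hvw; rwa [Function.update_self]
        · rw [Function.update_of_ne hvw]; exact h v ⟨hvw, hv⟩
    rw [this, Measure.prod_prod, hP _ t ht, Finset.prod_erase_mul _ _ hw]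
  · have : (fun p : Omega d m σm σp × Label d σm σp => Function.update p.1 w p.2) ⁻¹' (Set.pi S t)
        = {ω | ∀ v ∈ S, ω v ∈ t v} ×ˢ Set.univ := by
      ext ⟨ω, l⟩
      simp only [Set.mem_preimage, Set.mem_pi, Set.mem_prod, Set.mem_setOf_eq, Finset.mem_coe, Set.mem_univ, and_true]
      refine forall₂_congr fun v hv => ?_
      rw [Function.update_of_ne (by rintro rfl; exact hw hv)]
    rw [this, Measure.prod_prod, hP _ t ht, measure_univ, mul_one]

lemma lint_resample (h1 : σm < σp) (θ : Measure (Od d)) [IsProbabilityMeasure θ]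
    (P : Measure (Omega d m σm σp)) [IsProbabilityMeasure P] (hP : IsProductLaw θ P) (w : JW m)
    (f : Omega d m σm σp → ℝ≥0∞) (hf : Measurable f) :
    ∫⁻ ω, f ω ∂P = ∫⁻ ω, ∫⁻ l, f (Function.update ω w l) ∂(labelM σm σp θ) ∂P := by
  haveI := labelM_prob h1 θ
  rw [← (resample h1 θ P hP w).lintegral_comp hf, lintegral_prod]
  exact (hf.comp (measurable_upd w)).aemeasurable

lemma int_zero (h1 : σm < σp) (θ : Measure (Od d)) [IsProbabilityMeasure θ]
    (P : Measure (Omega d m σm σp)) [IsProbabilityMeasure P] (hP : IsProductLaw θ P) (w : JW m)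
    (G : Omega d m σm σp → ℝ) (h : Label d σm σp → ℝ) (hG : Measurable G) (hh : Measurable h)
    (hGw : ∀ ω l, G (Function.update ω w l) = G ω) (h0 : ∫ l, h l ∂(labelM σm σp θ) = 0) 
    (hi : Integrable (fun ω => G ω * h (ω w)) P) :
    ∫ ω, G ω * h (ω w) ∂P = 0 := by
  haveI := labelM_prob h1 θ
  have hm : Measurable fun ω : Omega d m σm σp => G ω * h (ω w) := hG.mul (hh.comp (measurable_pi_apply w))
  have mp := resample h1 θ P hP w
  have : ∫ ω, G ω * h (ω w) ∂P = ∫ p, G p.1 * h p.2 ∂(P.prod (labelM σm σp θ)) := by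
    conv_lhs => rw [← mp.map_eq]
    rw [integral_map mp.measurable.aemeasurable (by rw [mp.map_eq]; exact hm.aestronglyMeasurable)]
    simp [hGw]
  rw [this, integral_prod_mul, h0, mul_zero]

lemma pre_inj (i j : ℕ → Fin m) {n n' : ℕ} (h : pre i n = pre j n') : n = n' :=
  congrArg Sigma.fst h

lemma pre_eq_iff (i j : ℕ → Fin m) (n : ℕ) : pre i n = pre j n ↔ ∀ t ≤ n, i t = j t := by
  unfold pre
  constructor
  · intro h t ht
    have := eq_of_heq (Sigma.mk.inj h).2
    exact congrFun this ⟨t, by omega⟩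
  · intro h
    congr 1
    funext t
    exact h t.1 (by omega)

lemma lint_prod_nodes (h1 : σm < σp) (θ : Measure (Od d)) [IsProbabilityMeasure θ]
    (P : Measure (Omega d m σm σp)) [IsProbabilityMeasure P] (hP : IsProductLaw θ P)
    (i : ℕ → Fin m) (f : Label d σm σp → ℝ≥0∞) (hf : Measurable f) (F : Finset ℕ)
    (G : Omega d m σm σp → ℝ≥0∞) (hG : Measurable G)
    (hGF : ∀ n ∈ F, ∀ ω l, G (Function.update ω (pre i n) l) = G ω) :
    ∫⁻ ω, G ω * ∏ n ∈ F, f (ω (pre i n)) ∂P = (∫⁻ ω, G ω ∂P) * (∫⁻ l, f l ∂(labelM σm σp θ)) ^ F.card := by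
  induction F using Finset.induction_on with
  | empty => simp
  | insert a F ha ih =>
    have hmp : Measurable fun ω : Omega d m σm σp => ∏ n ∈ F, f (ω (pre i n)) :=
      Finset.measurable_prod _ (fun n _ => hf.comp (measurable_pi_apply _))
    simp only [Finset.prod_insert ha, Finset.card_insert_of_notMem ha]
    have hfa : Measurable fun ω : Omega d m σm σp => f (ω (pre i a)) := hf.comp (measurable_pi_apply _)
    rw [lint_resample h1 θ P hP (pre i a) (fun ω => G ω * (f (ω (pre i a)) * ∏ n ∈ F, f (ω (pre i n)))) (hG.mul (hfa.mul hmp))]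
    have : ∀ ω l, G (Function.update ω (pre i a) l) * (f (Function.update ω (pre i a) l (pre i a)) *
        ∏ n ∈ F, f (Function.update ω (pre i a) l (pre i n))) = (G ω * ∏ n ∈ F, f (ω (pre i n))) * f l := by
      intro ω l
      rw [hGF a (Finset.mem_insert_self _ _), Function.update_self]
      rw [Finset.prod_congr rfl (g := fun n => f (ω (pre i n)))]
      · ring
      · intro n hn
        rw [Function.update_of_ne]
        intro h
        exact ha (pre_inj i i h ▸ hn)
    simp only [this]
    simp only [lintegral_const_mul _ hf]
    rw [lintegral_mul_const _ (show Measurable fun ω => G ω * ∏ n ∈ F, f (ω (pre i n)) from hG.mul hmp), ih (fun n hn => hGF n (Finset.mem_insert_of_mem hn)), pow_succ, mul_assoc]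

lemma measurable_node (n : ℕ) :
    Measurable fun p : Omega d m σm σp × (ℕ → Fin m) => p.1 (pre p.2 n) := by
  have h1 : Measurable fun p : Omega d m σm σp × (Fin (n + 1) → Fin m) => p.1 ⟨n, p.2⟩ :=
    measurable_from_prod_countable_left (fun v => (measurable_pi_apply (⟨n, v⟩ : JW m) : Measurable fun ω : Omega d m σm σp => ω ⟨n,v⟩))
  have h2 : Measurable fun i : ℕ → Fin m => (fun j : Fin (n + 1) => i j.1) := by fun_prop
  exact h1.comp (measurable_fst.prodMk (h2.comp measurable_snd))

lemma meas_act {d : ℕ} : Measurable fun p : Od d × E d => act d p.1 p.2 :=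
  Continuous.measurable (γ := E d) (continuous_act (d := d))

lemma measurable_cumT (n : ℕ) (V : Omega d m σm σp × (ℕ → Fin m) → E d) (hV : Measurable V) :
    Measurable fun p : Omega d m σm σp × (ℕ → Fin m) => cumT p.1 p.2 n (V p) := by
  induction n generalizing V with
  | zero => simpa [cumT] using hV
  | succ n ih =>
    simp only [cumT, LinearMap.comp_apply]
    refine ih (fun p => Tnode p.1 (pre p.2 n) (V p)) ?_
    simp only [Tnode, LinearMap.smul_apply]
    have h := measurable_node (d := d) (m := m) (σm := σm) (σp := σp) n
    have h5 : Measurable fun p : Omega d m σm σp × (ℕ → Fin m) => (p.1 (pre p.2 n)).2 := measurable_snd.comp h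
    have h6 : Measurable fun p : Omega d m σm σp × (ℕ → Fin m) => ((p.1 (pre p.2 n)).2, V p) := h5.prodMk hV
    have h3 : Measurable fun p : Omega d m σm σp × (ℕ → Fin m) => act d (p.1 (pre p.2 n)).2 (V p) :=
      Measurable.comp (g := fun p : Od d × E d => act d p.1 p.2) (f := fun p : Omega d m σm σp × (ℕ → Fin m) => ((p.1 (pre p.2 n)).2, V p)) (meas_act (d := d)) h6
    have h4 : Measurable fun p : Omega d m σm σp × (ℕ → Fin m) => ((p.1 (pre p.2 n)).1 : ℝ) :=
      measurable_subtype_coe.comp (measurable_fst.comp h)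
    exact h4.smul h3

lemma measurable_aterm (a : Fin m → E d) (n : ℕ) :
    Measurable fun p : Omega d m σm σp × (ℕ → Fin m) => a (p.2 n) :=
  (measurable_of_finite a).comp ((measurable_pi_apply n).comp measurable_snd)

lemma norm_Tnode (h0 : 0 < σm) (ω : Omega d m σm σp) (w : JW m) (x : E d) :
    ‖Tnode ω w x‖ = (ω w).1 * ‖x‖ := by
  have := (ω w).1.2.1
  rw [Tnode, LinearMap.smul_apply, norm_smul, norm_act, Real.norm_of_nonneg (by linarith)]

lemma norm_cumT (h0 : 0 < σm) (ω : Omega d m σm σp) (i : ℕ → Fin m) (n : ℕ) (x : E d) :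
    ‖cumT ω i n x‖ = cumR ω i n * ‖x‖ := by
  induction n generalizing x with
  | zero => simp [cumT, cumR]
  | succ n ih =>
    rw [cumT, LinearMap.comp_apply, ih, norm_Tnode h0, cumR, cumR, Finset.prod_range_succ]
    ring

lemma cumR_pos (h0 : 0 < σm) (ω : Omega d m σm σp) (i : ℕ → Fin m) (n : ℕ) : 0 < cumR ω i n :=
  Finset.prod_pos fun k _ => h0.trans (ω _).1.2.1

lemma cumR_le (h0 : 0 < σm) (ω : Omega d m σm σp) (i : ℕ → Fin m) (n : ℕ) : cumR ω i n ≤ σp ^ n := by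
  calc cumR ω i n ≤ ∏ k ∈ Finset.range n, σp :=
        Finset.prod_le_prod (fun k _ => (h0.trans (ω _).1.2.1).le) (fun k _ => (ω _).1.2.2.le)
    _ = _ := by simp

lemma cumT_split (ω : Omega d m σm σp) (i : ℕ → Fin m) (k q : ℕ) (x : E d) :
    cumT ω i (k + 1 + q) x = cumT ω i k (Tnode ω (pre i k) (cumTFrom ω i k q x)) := by
  induction q generalizing x with
  | zero => simp [cumT, cumTFrom]
  | succ q ih =>
    rw [← add_assoc, cumT, LinearMap.comp_apply, ih, cumTFrom, LinearMap.comp_apply]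

lemma aBound (a : Fin m → E d) (i : Fin m) : ‖a i‖ ≤ ∑ j, ‖a j‖ :=
  Finset.single_le_sum (f := fun j => ‖a j‖) (fun _ _ => norm_nonneg _) (Finset.mem_univ i)

lemma summable_pi (h0 : 0 < σm) (h01 : σm < σp) (h2 : σp < 1) (a : Fin m → E d) (ω : Omega d m σm σp) (i : ℕ → Fin m) :
    Summable fun n => cumT ω i n (a (i n)) := by
  apply Summable.of_norm_bounded (g := fun n => σp ^ n * ∑ j, ‖a j‖)
  · exact (summable_geometric_of_lt_one (by linarith) h2).mul_right _
  · intro n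
    rw [norm_cumT h0]
    gcongr
    · exact pow_nonneg (by linarith) n
    · exact cumR_le h0 ω i n
    · exact aBound a _

lemma measurable_pi' (h0 : 0 < σm) (h01 : σm < σp) (h2 : σp < 1) (a : Fin m → E d) :
    Measurable fun p : Omega d m σm σp × (ℕ → Fin m) => piMap a p.1 p.2 := by
  refine measurable_of_tendsto_metrizable (f := fun n p => ∑ k ∈ Finset.range n, cumT p.1 p.2 k (a (p.2 k))) ?_ ?_
  · intro n
    exact Finset.measurable_sum _ fun k _ => measurable_cumT k _ (measurable_aterm a k)
  · rw [tendsto_pi_nhds]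
    intro p
    exact (summable_pi h0 h01 h2 a p.1 p.2).hasSum.tendsto_sum_nat

lemma summable_x (h0 : 0 < σm) (h01 : σm < σp) (h2 : σp < 1) (a : Fin m → E d) (ω : Omega d m σm σp) (i : ℕ → Fin m) (k : ℕ) :
    Summable fun q => cumTFrom ω i k q (a (i (k + 1 + q))) := by
  have h := (summable_nat_add_iff (k + 1)).2 (summable_pi h0 h01 h2 a ω i).norm
  have h3 := h.mul_left (cumR ω i (k + 1))⁻¹
  refine Summable.of_norm_bounded h3 ?_
  intro q
  rw [add_comm q (k + 1), cumT_split, norm_cumT h0, norm_Tnode h0, cumR, cumR, Finset.prod_range_succ, ← mul_assoc]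
  have p1 : 0 < ∏ x ∈ Finset.range k, ((ω (pre i x)).1 : ℝ) := cumR_pos h0 ω i k
  have p2 : 0 < ((ω (pre i k)).1 : ℝ) := h0.trans (ω _).1.2.1
  apply le_of_eq
  field_simp

lemma pi_split (h0 : 0 < σm) (h01 : σm < σp) (h2 : σp < 1) (a : Fin m → E d) (ω : Omega d m σm σp) (i : ℕ → Fin m) (k : ℕ) :
    piMap a ω i = ∑ n ∈ Finset.range k, cumT ω i n (a (i n)) + cumT ω i k (a (i k) + Tnode ω (pre i k) (xMap a ω i k)) := by
  unfold piMap
  rw [← (summable_pi h0 h01 h2 a ω i).sum_add_tsum_nat_add (k + 1), Finset.sum_range_succ, map_add, add_assoc]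
  congr 2
  have : ∀ q, cumT ω i (q + (k + 1)) (a (i (q + (k + 1)))) =
     (LinearMap.toContinuousLinearMap ((cumT ω i k).comp (Tnode ω (pre i k)))) (cumTFrom ω i k q (a (i (k + 1 + q)))) := by
    intro q
    rw [add_comm q (k + 1), cumT_split]
    rfl
  simp only [this]
  rw [← ContinuousLinearMap.map_tsum _ (summable_x h0 h01 h2 a ω i k)]
  rfl

lemma cumT_congr (ω ω' : Omega d m σm σp) (i j : ℕ → Fin m) (n : ℕ)
    (h : ∀ k < n, ω (pre i k) = ω' (pre j k)) : cumT ω i n = cumT ω' j n := by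
  induction n with
  | zero => rfl
  | succ n ih =>
    rw [cumT, cumT, ih (fun k hk => h k (by omega)), Tnode, Tnode, h n (by omega)]

lemma cumR_congr (ω ω' : Omega d m σm σp) (i j : ℕ → Fin m) (n : ℕ)
    (h : ∀ k < n, ω (pre i k) = ω' (pre j k)) : cumR ω i n = cumR ω' j n :=
  Finset.prod_congr rfl fun k hk => by rw [h k (Finset.mem_range.1 hk)]

lemma xMap_congr (a : Fin m → E d) (ω ω' : Omega d m σm σp) (i : ℕ → Fin m) (k : ℕ)
    (h : ∀ n, k < n → ω (pre i n) = ω' (pre i n)) : xMap a ω i k = xMap a ω' i k := by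
  have : ∀ q, cumTFrom ω i k q = cumTFrom ω' i k q := by
    intro q
    induction q with
    | zero => rfl
    | succ q ih => rw [cumTFrom, cumTFrom, ih, Tnode, Tnode, h _ (by omega)]
  simp only [xMap, this]

lemma pi_diff (h0 : 0 < σm) (h01 : σm < σp) (h2 : σp < 1) (a : Fin m → E d) (ω : Omega d m σm σp) (i j : ℕ → Fin m) (k : ℕ)
    (hij : ∀ t < k, i t = j t) :
    ‖piMap a ω i - piMap a ω j‖ = cumR ω i k *
      ‖Tnode ω (pre i k) (xMap a ω i k) - (a (j k) + Tnode ω (pre j k) (xMap a ω j k) - a (i k))‖ := by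
  have hp : ∀ n < k, ω (pre i n) = ω (pre j n) := fun n hn => by
    rw [(pre_eq_iff i j n).2 (fun t ht => hij t (by omega))]
  rw [pi_split h0 h01 h2 a ω i k, pi_split h0 h01 h2 a ω j k, ← norm_cumT h0]
  rw [← cumT_congr ω ω i j k hp]
  rw [Finset.sum_congr rfl (g := fun n => cumT ω j n (a (j n)))]
  · rw [add_sub_add_left_eq_sub, ← map_sub]
    congr 2
    abel
  · intro n hn
    have hn := Finset.mem_range.1 hn
    rw [cumT_congr ω ω i j n (fun t ht => hp t (by omega)), hij n hn]

lemma measurable_x (h0 : 0 < σm) (h01 : σm < σp) (h2 : σp < 1) (a : Fin m → E d) (i : ℕ → Fin m) (k : ℕ) :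
    Measurable fun ω : Omega d m σm σp => ‖xMap a ω i k‖ := by
  have : ∀ ω : Omega d m σm σp, ‖xMap a ω i k‖ = (cumR ω i (k + 1))⁻¹ * 
      ‖piMap a ω i - ∑ n ∈ Finset.range (k + 1), cumT ω i n (a (i n))‖ := by
    intro ω
    rw [pi_split h0 h01 h2 a ω i k, Finset.sum_range_succ, map_add, add_sub_add_left_eq_sub,
      add_sub_cancel_left, norm_cumT h0, norm_Tnode h0, cumR, cumR, Finset.prod_range_succ]
    have p1 : 0 < ∏ x ∈ Finset.range k, ((ω (pre i x)).1 : ℝ) := cumR_pos h0 ω i k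
    have p2 : 0 < ((ω (pre i k)).1 : ℝ) := h0.trans (ω _).1.2.1
    field_simp
  simp only [this]
  have hc : Measurable fun ω : Omega d m σm σp => cumR ω i (k + 1) :=
    Finset.measurable_prod _ fun n _ => measurable_subtype_coe.comp (measurable_fst.comp (measurable_pi_apply _))
  have hi : Measurable fun ω : Omega d m σm σp => (ω, i) := measurable_id.prodMk measurable_const
  have hp := (measurable_pi' h0 h01 h2 a).comp hi
  have hs : Measurable fun ω : Omega d m σm σp => ∑ n ∈ Finset.range (k + 1), cumT ω i n (a (i n)) :=
    Finset.measurable_sum _ fun n _ => (measurable_cumT n _ (measurable_aterm a n)).comp hi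
  exact hc.inv.mul (hp.sub hs).norm

end resample

section weights
variable {d m : ℕ} {σm σp : ℝ}

noncomputable def wtR (m : ℕ) (s : ℝ) (l : Label d σm σp) : ℝ := m * (l.1 : ℝ) ^ s
noncomputable def wtE (m : ℕ) (s : ℝ) (l : Label d σm σp) : ℝ≥0∞ := ENNReal.ofReal (wtR m s l)

lemma wtR_pos (hm : 2 ≤ m) (h0 : 0 < σm) (s : ℝ) (l : Label d σm σp) : 0 < wtR m s l := by
  have : (0:ℝ) < l.1 := h0.trans l.1.2.1
  unfold wtR
  have : (0:ℝ) < m := by exact_mod_cast (by omega : 0 < m)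
  positivity

lemma wtR_le' (h0 : 0 < σm) {s : ℝ} (hs : 0 < s) (l : Label d σm σp) : wtR m s l ≤ m * σp ^ s := by
  have h := h0.trans l.1.2.1
  unfold wtR
  gcongr
  exact l.1.2.2.le

lemma wtR_le (h0 : 0 < σm) (h2 : σp < 1) {s : ℝ} (hs : 0 < s) (l : Label d σm σp) : wtR m s l ≤ m := by
  refine (wtR_le' h0 hs l).trans ?_
  have h := (h0.trans l.1.2.1).trans l.1.2.2
  have : σp ^ s ≤ 1 := Real.rpow_le_one h.le h2.le hs.le
  have : (0:ℝ) ≤ m := by positivity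
  nlinarith

lemma meas_wtR (m : ℕ) (s : ℝ) : Measurable fun l : Label d σm σp => wtR m s l := by
  unfold wtR
  have : Measurable fun l : Label d σm σp => (l.1 : ℝ) := measurable_subtype_coe.comp measurable_fst
  exact (this.pow_const s).const_mul _

lemma meas_wtE (m : ℕ) (s : ℝ) : Measurable fun l : Label d σm σp => wtE m s l :=
  (meas_wtR m s).ennreal_ofReal

lemma wtE_le (h0 : 0 < σm) (h2 : σp < 1) {s : ℝ} (hs : 0 < s) (l : Label d σm σp) : wtE m s l ≤ m := by
  unfold wtE
  rw [← ENNReal.ofReal_natCast]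
  exact ENNReal.ofReal_le_ofReal (wtR_le h0 h2 hs l)

lemma lint_W (h0 : 0 < σm) (h1 : σm < σp) (θ : Measure (Od d)) [IsProbabilityMeasure θ] {s : ℝ}
    (hs : ((m : ℝ) / (σp - σm)) * (∫ r in σm..σp, r ^ s) = 1) :
    ∫⁻ l, wtE m s l ∂(labelM σm σp θ) = 1 := by
  haveI := unifSub_prob h1
  unfold labelM
  rw [lintegral_prod _ (meas_wtE m s).aemeasurable]
  simp only [wtE, wtR, lintegral_const, measure_univ, mul_one]
  unfold unifSub
  rw [lintegral_smul_measure, lintegral_subtype_comap measurableSet_Ioo (fun r : ℝ => ENNReal.ofReal (m * r ^ s))]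
  have hint : IntegrableOn (fun r : ℝ => (m:ℝ) * r ^ s) (Set.Ioo σm σp) := by
    have : IntervalIntegrable (fun r : ℝ => r ^ s) volume σm σp := by
      apply intervalIntegral.intervalIntegrable_rpow
      right
      rw [Set.uIcc_of_le h1.le]
      intro h; linarith [h.1]
    rw [intervalIntegrable_iff_integrableOn_Ioo_of_le h1.le] at this
    exact this.const_mul _
  rw [← ofReal_integral_eq_lintegral_ofReal hint]
  · rw [integral_const_mul, ← integral_Ioc_eq_integral_Ioo, ← intervalIntegral.integral_of_le h1.le, smul_eq_mul,
      ← ENNReal.ofReal_inv_of_pos (by linarith), ← ENNReal.ofReal_mul (by have : 0 < σp - σm := by linarith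
                                                                          positivity)]
    rw [← mul_assoc, inv_mul_eq_div, hs, ENNReal.ofReal_one]
  · refine (ae_restrict_iff' measurableSet_Ioo).2 (Eventually.of_forall fun r hr => ?_)
    have : 0 < r := h0.trans hr.1
    show 0 ≤ (m:ℝ) * r ^ s
    positivity

lemma int_wtR (hm : 2 ≤ m) (h0 : 0 < σm) (h1 : σm < σp) (θ : Measure (Od d)) [IsProbabilityMeasure θ] {s : ℝ}
    (hs : ((m : ℝ) / (σp - σm)) * (∫ r in σm..σp, r ^ s) = 1) :
    ∫ l, wtR m s l ∂(labelM σm σp θ) = 1 := by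
  rw [integral_eq_lintegral_of_nonneg_ae (Eventually.of_forall fun l => (wtR_pos hm h0 s l).le)
    (meas_wtR m s).aestronglyMeasurable]
  have := lint_W h0 h1 θ hs
  unfold wtE at this
  rw [this]; simp

lemma lint_W2 (h0 : 0 < σm) (h1 : σm < σp) (θ : Measure (Od d)) [IsProbabilityMeasure θ] {s : ℝ} (hs0 : 0 < s)
    (hs : ((m : ℝ) / (σp - σm)) * (∫ r in σm..σp, r ^ s) = 1) :
    ∫⁻ l, (wtE m s l) ^ 2 ∂(labelM σm σp θ) ≤ ENNReal.ofReal (m * σp ^ s) := by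
  calc ∫⁻ l, (wtE m s l) ^ 2 ∂(labelM σm σp θ) ≤ ∫⁻ l, ENNReal.ofReal (m * σp ^ s) * (wtE m s l) ∂(labelM σm σp θ) := by
        refine lintegral_mono fun l => ?_
        rw [sq]
        gcongr
        exact ENNReal.ofReal_le_ofReal (wtR_le' h0 hs0 l)
    _ = _ := by rw [lintegral_const_mul _ (meas_wtE m s), lint_W h0 h1 θ hs, mul_one]

noncomputable def wtV (m : ℕ) (s : ℝ) (l : Label d σm σp) : ℝ≥0∞ := (wtE m s l) ^ 2 * (ENNReal.ofReal (l.1 : ℝ)⁻¹) ^ d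

lemma meas_wtV (m : ℕ) (s : ℝ) : Measurable fun l : Label d σm σp => wtV m s l := by
  have : Measurable fun l : Label d σm σp => (l.1 : ℝ) := measurable_subtype_coe.comp measurable_fst
  exact ((meas_wtE m s).pow_const 2).mul (this.inv.ennreal_ofReal.pow_const d)

lemma lint_V (h0 : 0 < σm) (h1 : σm < σp) (θ : Measure (Od d)) [IsProbabilityMeasure θ] {s : ℝ} (hsd : (d:ℝ) < s)
    (hs : ((m : ℝ) / (σp - σm)) * (∫ r in σm..σp, r ^ s) = 1) :
    ∫⁻ l, wtV m s l ∂(labelM σm σp θ) ≤ ENNReal.ofReal (m * σp ^ (s - d)) := by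
  calc ∫⁻ l, wtV m s l ∂(labelM σm σp θ) ≤ ∫⁻ l, ENNReal.ofReal (m * σp ^ (s - d)) * (wtE m s l) ∂(labelM σm σp θ) := by
        refine lintegral_mono fun l => ?_
        have hl := h0.trans l.1.2.1
        unfold wtV
        have : (wtE m s l) * (ENNReal.ofReal (l.1 : ℝ)⁻¹) ^ d ≤ ENNReal.ofReal (m * σp ^ (s - d)) := by
          rw [wtE, ← ENNReal.ofReal_pow (by positivity), ← ENNReal.ofReal_mul (by unfold wtR; positivity)]
          apply ENNReal.ofReal_le_ofReal
          unfold wtR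
          have e : (l.1:ℝ) ^ s * ((l.1:ℝ)⁻¹) ^ d = (l.1:ℝ) ^ (s - d) := by
            rw [Real.rpow_sub hl, Real.rpow_natCast, inv_pow]; rfl
          rw [mul_assoc, e]
          gcongr
          exact l.1.2.2.le
        calc (wtE m s l) ^ 2 * (ENNReal.ofReal (l.1 : ℝ)⁻¹) ^ d = ((wtE m s l) * (ENNReal.ofReal (l.1 : ℝ)⁻¹) ^ d) * wtE m s l := by ring
          _ ≤ _ := by gcongr
    _ = _ := by rw [lintegral_const_mul _ (meas_wtE m s), lint_W h0 h1 θ hs, mul_one]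

end weights

section twopoint
variable {d m : ℕ} {σm σp : ℝ}

lemma hitA (h0 : 0 < σm) (h01 : σm < σp) (h2 : σp < 1)
    (θ : Measure (Od d)) [IsProbabilityMeasure θ]
    (P : Measure (Omega d m σm σp)) [IsProbabilityMeasure P] (hP : IsProductLaw θ P) (a : Fin m → E d)
    (δ : ℝ) (C : ℝ≥0∞)
    (hC : ∀ (x y : E d) (ρ : ℝ), δ ≤ ‖x‖ → labelM σm σp θ {l | ‖(l.1:ℝ) • act d l.2 x - y‖ < ρ} ≤ C * (ENNReal.ofReal ρ)^d)
    (i j : ℕ → Fin m) (k : ℕ) (hij : ∀ t < k, i t = j t) (hk : i k ≠ j k) (ρ : ℝ)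
    (G : Omega d m σm σp → ℝ≥0∞) (hG : Measurable G)
    (hGw : ∀ ω l, G (Function.update ω (pre i k) l) = G ω) :
    ∫⁻ ω, G ω * Set.indicator {ω | ‖piMap a ω i - piMap a ω j‖ < ρ ∧ δ ≤ ‖xMap a ω i k‖} 1 ω ∂P ≤
      C * ∫⁻ ω, G ω * ENNReal.ofReal (ρ / cumR ω i k) ^ d ∂P := by
  have hi : ∀ i : ℕ → Fin m, Measurable fun ω : Omega d m σm σp => (ω, i) := fun i => measurable_id.prodMk measurable_const
  have hpi : ∀ i : ℕ → Fin m, Measurable fun ω : Omega d m σm σp => piMap a ω i := fun i => (measurable_pi' h0 h01 h2 a).comp (hi i)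
  have hS : MeasurableSet {ω : Omega d m σm σp | ‖piMap a ω i - piMap a ω j‖ < ρ ∧ δ ≤ ‖xMap a ω i k‖} :=
    (measurableSet_lt ((hpi i).sub (hpi j)).norm measurable_const).inter
      (measurableSet_le measurable_const (measurable_x h0 h01 h2 a i k))
  have hc : Measurable fun ω : Omega d m σm σp => cumR ω i k :=
    Finset.measurable_prod _ fun n _ => measurable_subtype_coe.comp (measurable_fst.comp (measurable_pi_apply _))
  have hmG : Measurable fun ω : Omega d m σm σp => G ω * ENNReal.ofReal (ρ / cumR ω i k) ^ d :=
    hG.mul ((measurable_const.div hc).ennreal_ofReal.pow_const d)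
  rw [← lintegral_const_mul _ hmG]
  rw [lint_resample h01 θ P hP (pre i k)
    (fun ω => G ω * Set.indicator {ω | ‖piMap a ω i - piMap a ω j‖ < ρ ∧ δ ≤ ‖xMap a ω i k‖} 1 ω)
    (hG.mul (measurable_one.indicator hS))]
  refine lintegral_mono fun ω => ?_
  have hR := cumR_pos h0 ω i k
  have hne : pre j k ≠ pre i k := fun h => hk (((pre_eq_iff j i k).1 h k le_rfl).symm)
  set y := (a (j k) + Tnode ω (pre j k) (xMap a ω j k) - a (i k)) with hy
  have key : ∀ l, Set.indicator {ω | ‖piMap a ω i - piMap a ω j‖ < ρ ∧ δ ≤ ‖xMap a ω i k‖} 1 (Function.update ω (pre i k) l)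
      = (if δ ≤ ‖xMap a ω i k‖ then Set.indicator {l : Label d σm σp | ‖(l.1:ℝ) • act d l.2 (xMap a ω i k) - y‖ < ρ / cumR ω i k} (1 : Label d σm σp → ℝ≥0∞) l else (0 : ℝ≥0∞)) := by
    intro l
    have e1 : xMap a (Function.update ω (pre i k) l) i k = xMap a ω i k :=
      xMap_congr a _ _ i k fun n hn => Function.update_of_ne (fun h => by have := pre_inj _ _ h; omega) _ _
    have e2 : xMap a (Function.update ω (pre i k) l) j k = xMap a ω j k :=
      xMap_congr a _ _ j k fun n hn => Function.update_of_ne (fun h => by have := pre_inj _ _ h; omega) _ _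
    have e3 : cumR (Function.update ω (pre i k) l) i k = cumR ω i k :=
      cumR_congr _ _ i i k fun n hn => Function.update_of_ne (fun h => by have := pre_inj _ _ h; omega) _ _
    have e4 : ‖piMap a (Function.update ω (pre i k) l) i - piMap a (Function.update ω (pre i k) l) j‖ < ρ ↔
        ‖(l.1:ℝ) • act d l.2 (xMap a ω i k) - y‖ < ρ / cumR ω i k := by
      rw [pi_diff h0 h01 h2 a _ i j k hij, e1, e2, e3, lt_div_iff₀ hR, mul_comm]
      simp only [Tnode, Function.update_self, Function.update_of_ne hne, LinearMap.smul_apply, hy]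
    by_cases hx : δ ≤ ‖xMap a ω i k‖
    · simp only [hx, if_true, Set.indicator_apply, Set.mem_setOf_eq, e1, e4, and_true, Pi.one_apply]
    · simp only [hx, if_false, Set.indicator_apply, Set.mem_setOf_eq, e1, and_false]
  simp only [hGw, key]
  by_cases hx : δ ≤ ‖xMap a ω i k‖
  · simp only [hx, if_true]
    have hset : MeasurableSet {l : Label d σm σp | ‖(l.1:ℝ) • act d l.2 (xMap a ω i k) - y‖ < ρ / cumR ω i k} :=
      measurableSet_lt (((act_smul_measurable _).sub_const y).norm) measurable_const
    rw [lintegral_const_mul _ (measurable_one.indicator hset), lintegral_indicator_one hset]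
    calc _ ≤ G ω * (C * ENNReal.ofReal (ρ / cumR ω i k) ^ d) := by gcongr; exact hC _ _ _ hx
      _ = _ := by ring
  · simp [hx]

end twopoint

section twopoint
variable {d m : ℕ} {σm σp : ℝ}

noncomputable def DE (s : ℝ) (k N : ℕ) (ω : Omega d m σm σp) (i : ℕ → Fin m) : ℝ≥0∞ :=
  ∏ n ∈ Finset.Ico k N, wtE m s (ω (pre i n))

noncomputable def HH (s : ℝ) (i j : ℕ → Fin m) (k N : ℕ) (ω : Omega d m σm σp) : ℝ≥0∞ :=
  (∏ n ∈ Finset.range k, (wtE m s (ω (pre i n))) ^ 2) * (DE s (k+1) N ω i * DE s (k+1) N ω j)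

lemma meas_nodeprod (f : Label d σm σp → ℝ≥0∞) (hf : Measurable f) (i : ℕ → Fin m) (F : Finset ℕ) :
    Measurable fun ω : Omega d m σm σp => ∏ n ∈ F, f (ω (pre i n)) :=
  Finset.measurable_prod _ (fun n _ => hf.comp (measurable_pi_apply _))

lemma meas_HH (s : ℝ) (i j : ℕ → Fin m) (k N : ℕ) : Measurable fun ω : Omega d m σm σp => HH s i j k N ω :=
  (meas_nodeprod _ ((meas_wtE m s).pow_const 2) i _).mul
    ((meas_nodeprod _ (meas_wtE m s) i _).mul (meas_nodeprod _ (meas_wtE m s) j _))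

lemma prod_upd (f : Label d σm σp → ℝ≥0∞) (i : ℕ → Fin m) (F : Finset ℕ) (w : JW m) (hw : ∀ n ∈ F, pre i n ≠ w)
   (ω : Omega d m σm σp) (l) : ∏ n ∈ F, f (Function.update ω w l (pre i n)) = ∏ n ∈ F, f (ω (pre i n)) :=
  Finset.prod_congr rfl fun n hn => by rw [Function.update_of_ne (hw n hn)]

lemma HH_upd (s : ℝ) (i j v : ℕ → Fin m) (k N : ℕ) (ω : Omega d m σm σp) (l) :
    HH s i j k N (Function.update ω (pre v k) l) = HH s i j k N ω := by
  unfold HH DE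
  rw [prod_upd (fun l => wtE m s l ^ 2), prod_upd (wtE m s), prod_upd (wtE m s)]
  all_goals
    intro n hn h
    have := pre_inj _ _ h
    simp at hn
    omega

lemma DD_le_HH (h0 : 0 < σm) (h2 : σp < 1) {s : ℝ} (hs : 0 < s) (i j : ℕ → Fin m) (k N : ℕ) (hkN : k < N)
    (hij : ∀ t < k, i t = j t) (ω : Omega d m σm σp) :
    DE s 0 N ω i * DE s 0 N ω j ≤ (m:ℝ≥0∞) ^ 2 * HH s i j k N ω := by
  have hsp : ∀ i : ℕ → Fin m, DE s 0 N ω i = (∏ n ∈ Finset.range k, wtE m s (ω (pre i n))) * (wtE m s (ω (pre i k)) * DE s (k+1) N ω i) := by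
    intro i
    unfold DE
    rw [← Finset.prod_Ico_consecutive _ (Nat.zero_le k) hkN.le, Finset.prod_eq_prod_Ico_succ_bot hkN, Finset.range_eq_Ico]
  rw [hsp i, hsp j]
  have e : ∏ n ∈ Finset.range k, wtE m s (ω (pre j n)) = ∏ n ∈ Finset.range k, wtE m s (ω (pre i n)) := by
    refine Finset.prod_congr rfl fun n hn => ?_
    have := Finset.mem_range.1 hn
    rw [(pre_eq_iff i j n).2 (fun t ht => hij t (by omega))]
  rw [e]
  unfold HH
  rw [Finset.prod_pow]
  calc _ = (wtE m s (ω (pre i k)) * wtE m s (ω (pre j k))) * ((∏ n ∈ Finset.range k, wtE m s (ω (pre i n))) ^ 2 * (DE s (k+1) N ω i * DE s (k+1) N ω j)) := by ring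
    _ ≤ _ := by
      gcongr
      rw [sq]
      gcongr <;> exact wtE_le h0 h2 hs _

lemma lint_HR (h0 : 0 < σm) (h01 : σm < σp)
    (θ : Measure (Od d)) [IsProbabilityMeasure θ]
    (P : Measure (Omega d m σm σp)) [IsProbabilityMeasure P] (hP : IsProductLaw θ P) {s : ℝ} (hsd : (d:ℝ) < s)
    (hs : ((m : ℝ) / (σp - σm)) * (∫ r in σm..σp, r ^ s) = 1)
    (i j : ℕ → Fin m) (k N : ℕ) (hk : i k ≠ j k) (ρ : ℝ) (hρ : 0 < ρ) :
    ∫⁻ ω, HH s i j k N ω * ENNReal.ofReal (ρ / cumR ω i k) ^ d ∂P ≤ 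
      ENNReal.ofReal ρ ^ d * ENNReal.ofReal (m * σp ^ (s - d)) ^ k := by
  have e : ∀ ω : Omega d m σm σp, HH s i j k N ω * ENNReal.ofReal (ρ / cumR ω i k) ^ d =
     ENNReal.ofReal ρ ^ d * (((∏ n ∈ Finset.range k, wtV m s (ω (pre i n))) * DE s (k+1) N ω i) * DE s (k+1) N ω j) := by
    intro ω
    have : ENNReal.ofReal (ρ / cumR ω i k) ^ d = ENNReal.ofReal ρ ^ d * ∏ n ∈ Finset.range k, (ENNReal.ofReal ((ω (pre i n)).1 : ℝ)⁻¹) ^ d := by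
      rw [Finset.prod_pow, ← mul_pow, ← ENNReal.ofReal_prod_of_nonneg, ← ENNReal.ofReal_mul hρ.le, Finset.prod_inv_distrib, div_eq_mul_inv, cumR]
      intro n _
      have := h0.trans (ω (pre i n)).1.2.1
      positivity
    rw [this]
    unfold HH wtV
    rw [Finset.prod_mul_distrib]
    ring
  simp only [e]
  have mV := meas_nodeprod (d := d) (m := m) (σm := σm) (σp := σp) _ (meas_wtV m s) i (Finset.range k)
  have mW := fun v => meas_nodeprod (d := d) (m := m) (σm := σm) (σp := σp) _ (meas_wtE m s) v (Finset.Ico (k+1) N)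
  have mVW : Measurable fun ω : Omega d m σm σp => (∏ n ∈ Finset.range k, wtV m s (ω (pre i n))) * DE s (k+1) N ω i := mV.mul (mW i)
  have mVWW : Measurable fun ω : Omega d m σm σp => ((∏ n ∈ Finset.range k, wtV m s (ω (pre i n))) * DE s (k+1) N ω i) * DE s (k+1) N ω j := mVW.mul (mW j)
  rw [lintegral_const_mul _ mVWW]
  gcongr
  have s1 := lint_prod_nodes h01 θ P hP j (wtE m s) (meas_wtE m s) (Finset.Ico (k+1) N) _ mVW (by
    intro n hn ω l
    unfold DE
    have hn := Finset.mem_Ico.1 hn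
    rw [prod_upd (wtV m s), prod_upd (wtE m s)]
    · intro n' hn' h
      have := pre_inj _ _ h
      subst this
      exact hk ((pre_eq_iff i j n').1 h k (by omega))
    · intro n' hn' h
      have := pre_inj _ _ h
      simp at hn'
      omega)
  have s2 := lint_prod_nodes h01 θ P hP i (wtE m s) (meas_wtE m s) (Finset.Ico (k+1) N) _ mV (by
    intro n hn ω l
    have hn := Finset.mem_Ico.1 hn
    rw [prod_upd (wtV m s)]
    intro n' hn' h
    have := pre_inj _ _ h
    simp at hn'
    omega)
  have s3 := lint_prod_nodes h01 θ P hP i (wtV m s) (meas_wtV m s) (Finset.range k) (fun _ => 1) measurable_const (by simp)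
  rw [lint_W h0 h01 θ hs, one_pow, mul_one] at s1 s2
  simp only [one_mul, lintegral_const, measure_univ, Finset.card_range] at s3
  refine (s1.trans (s2.trans s3)).le.trans ?_
  gcongr
  exact lint_V h0 h01 θ hsd hs

lemma twopoint (hd : 1 ≤ d) (hm : 2 ≤ m) (h0 : 0 < σm) (h01 : σm < σp) (h2 : σp < 1)
    (θ : Measure (Od d)) [IsProbabilityMeasure θ] [θ.IsMulLeftInvariant]
    (P : Measure (Omega d m σm σp)) [IsProbabilityMeasure P] (hP : IsProductLaw θ P) {s : ℝ} (hsd : (d:ℝ) < s)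
    (hs : ((m : ℝ) / (σp - σm)) * (∫ r in σm..σp, r ^ s) = 1)
    (a : Fin m → E d) (ha : Function.Injective a) :
    ∃ C : ℝ≥0∞, C ≠ ⊤ ∧ ∀ (i j : ℕ → Fin m) (k N : ℕ) (ρ : ℝ), k < N → 0 < ρ → (∀ t < k, i t = j t) → i k ≠ j k →
    ∫⁻ ω, DE s 0 N ω i * DE s 0 N ω j * Set.indicator {ω | ‖piMap a ω i - piMap a ω j‖ < ρ} 1 ω ∂P ≤ 
      C * ENNReal.ofReal ρ ^ d * ENNReal.ofReal (m * σp ^ (s - d)) ^ k := by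
  have hs0 : 0 < s := lt_of_le_of_lt (Nat.cast_nonneg d) hsd
  obtain ⟨δ, hδ, hδa⟩ : ∃ δ : ℝ, 0 < δ ∧ ∀ u v, u ≠ v → δ ≤ ‖a u - a v‖ := by
    have hf : (Set.range a).Finite := Set.finite_range a
    obtain ⟨δ, hδ, h⟩ : ∃ δ : ℝ, 0 < δ ∧ ∀ p ∈ (Finset.univ : Finset (Fin m × Fin m)), p.1 ≠ p.2 → δ ≤ ‖a p.1 - a p.2‖ := by
      generalize (Finset.univ : Finset (Fin m × Fin m)) = F
      induction F using Finset.induction_on with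
      | empty => exact ⟨1, one_pos, by simp⟩
      | insert p F hp ih =>
        obtain ⟨δ, hδ, h⟩ := ih
        by_cases hpp : p.1 = p.2
        · refine ⟨δ, hδ, fun q hq hqq => ?_⟩
          rcases Finset.mem_insert.1 hq with rfl | hq
          · exact absurd hpp hqq
          · exact h q hq hqq
        · refine ⟨min δ ‖a p.1 - a p.2‖, lt_min hδ (norm_pos_iff.2 (sub_ne_zero.2 fun h => hpp (ha h))), fun q hq hqq => ?_⟩
          rcases Finset.mem_insert.1 hq with rfl | hq
          · exact min_le_right _ _
          · exact (min_le_left _ _).trans (h q hq hqq)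
    exact ⟨δ, hδ, fun u v huv => h (u, v) (Finset.mem_univ _) huv⟩
  obtain ⟨C, hC, hhit⟩ := hit (d := d) hd h0 h01 θ (δ / 4) (by positivity)
  refine ⟨(m:ℝ≥0∞) ^ 2 * (ENNReal.ofReal (2 / δ) ^ d + C + C), ?_, ?_⟩
  · refine ENNReal.mul_ne_top (by simp) ?_
    simp [hC]
  intro i j k N ρ hkN hρ hij hk
  set A : (ℕ → Fin m) → (ℕ → Fin m) → Set (Omega d m σm σp) := fun i j => {ω | ‖piMap a ω i - piMap a ω j‖ < ρ ∧ δ / 4 ≤ ‖xMap a ω i k‖} with hA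
  have hi : ∀ i : ℕ → Fin m, Measurable fun ω : Omega d m σm σp => (ω, i) := fun i => measurable_id.prodMk measurable_const
  have hpi : ∀ i : ℕ → Fin m, Measurable fun ω : Omega d m σm σp => piMap a ω i := fun i => (measurable_pi' h0 h01 h2 a).comp (hi i)
  have hS : ∀ i j, MeasurableSet (A i j) := fun i j =>
    (measurableSet_lt ((hpi i).sub (hpi j)).norm measurable_const).inter
      (measurableSet_le measurable_const (measurable_x h0 h01 h2 a i k))
  have hc : Measurable fun ω : Omega d m σm σp => cumR ω i k :=
    Finset.measurable_prod _ fun n _ => measurable_subtype_coe.comp (measurable_fst.comp (measurable_pi_apply _))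
  have hmG : Measurable fun ω : Omega d m σm σp => HH s i j k N ω * ENNReal.ofReal (ρ / cumR ω i k) ^ d :=
    (meas_HH s i j k N).mul ((measurable_const.div hc).ennreal_ofReal.pow_const d)
  have hRij : ∀ ω : Omega d m σm σp, cumR ω j k = cumR ω i k := fun ω => cumR_congr _ _ _ _ _ fun n hn => by
    rw [(pre_eq_iff i j n).2 (fun t ht => hij t (by omega))]
  have pt : ∀ ω : Omega d m σm σp, DE s 0 N ω i * DE s 0 N ω j * Set.indicator {ω | ‖piMap a ω i - piMap a ω j‖ < ρ} 1 ω ≤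
      (m:ℝ≥0∞) ^ 2 * ((ENNReal.ofReal (2 / δ) ^ d * (HH s i j k N ω * ENNReal.ofReal (ρ / cumR ω i k) ^ d) +
        HH s i j k N ω * (A i j).indicator 1 ω) + HH s i j k N ω * (A j i).indicator 1 ω) := by
    intro ω
    have hR := cumR_pos h0 ω i k
    have b : Set.indicator {ω | ‖piMap a ω i - piMap a ω j‖ < ρ} (1 : Omega d m σm σp → ℝ≥0∞) ω ≤ 
       ENNReal.ofReal (2 / δ) ^ d * ENNReal.ofReal (ρ / cumR ω i k) ^ d + (A i j).indicator 1 ω + (A j i).indicator 1 ω := by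
      by_cases hρ' : ‖piMap a ω i - piMap a ω j‖ < ρ
      · rw [Set.indicator_of_mem (by exact hρ')]
        by_cases c1 : δ / 4 ≤ ‖xMap a ω i k‖
        · rw [Set.indicator_of_mem (s := A i j) (by exact ⟨hρ', c1⟩)]
          exact le_add_right (le_add_left le_rfl)
        by_cases c2 : δ / 4 ≤ ‖xMap a ω j k‖
        · rw [Set.indicator_of_mem (s := A j i) (by exact ⟨by rw [norm_sub_rev]; exact hρ', c2⟩)]
          exact le_add_left le_rfl
        · refine le_add_right (le_add_right ?_)
          rw [← mul_pow, ← ENNReal.ofReal_mul (by positivity)]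
          refine one_le_pow₀ ?_
          rw [← ENNReal.ofReal_one]
          apply ENNReal.ofReal_le_ofReal
          rw [pi_diff h0 h01 h2 a ω i j k hij] at hρ'
          have q1 : ‖Tnode ω (pre i k) (xMap a ω i k)‖ ≤ δ / 4 := by
            rw [norm_Tnode h0]
            have := (ω (pre i k)).1.2
            nlinarith [this.1, this.2, norm_nonneg (xMap a ω i k)]
          have q2 : ‖Tnode ω (pre j k) (xMap a ω j k)‖ ≤ δ / 4 := by
            rw [norm_Tnode h0]
            have := (ω (pre j k)).1.2
            nlinarith [this.1, this.2, norm_nonneg (xMap a ω j k)]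
          have q3 := hδa _ _ hk
          have q4 : ‖a (i k) - a (j k)‖ ≤ ‖Tnode ω (pre i k) (xMap a ω i k) - (a (j k) + Tnode ω (pre j k) (xMap a ω j k) - a (i k))‖
             + ‖Tnode ω (pre j k) (xMap a ω j k)‖ + ‖Tnode ω (pre i k) (xMap a ω i k)‖ := by
            refine le_trans (le_of_eq ?_) ((norm_sub_le _ _).trans (add_le_add_left (norm_add_le _ _) _))
            congr 1
            abel
          have q5 : δ / 2 ≤ ‖Tnode ω (pre i k) (xMap a ω i k) - (a (j k) + Tnode ω (pre j k) (xMap a ω j k) - a (i k))‖ := by linarith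
          have q6 : cumR ω i k * (δ / 2) ≤ ρ := (mul_le_mul_of_nonneg_left q5 hR.le).trans hρ'.le
          rw [div_mul_div_comm, le_div_iff₀ (by positivity)]
          linarith
      · rw [Set.indicator_of_notMem (by exact hρ')]
        exact bot_le
    calc _ ≤ ((m:ℝ≥0∞) ^ 2 * HH s i j k N ω) * (ENNReal.ofReal (2 / δ) ^ d * ENNReal.ofReal (ρ / cumR ω i k) ^ d + (A i j).indicator 1 ω + (A j i).indicator 1 ω) := by
          exact mul_le_mul' (DD_le_HH h0 h2 hs0 i j k N hkN hij ω) b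
      _ = _ := by ring
  refine (lintegral_mono pt).trans ?_
  have mH := meas_HH (d := d) (σm := σm) (σp := σp) s i j k N
  have mi : ∀ i j, Measurable fun ω : Omega d m σm σp => (A i j).indicator (1 : Omega d m σm σp → ℝ≥0∞) ω := fun i j => measurable_one.indicator (hS i j)
  have m1 : Measurable fun ω => HH s i j k N ω * (A i j).indicator 1 ω := mH.mul (mi i j)
  have m2 : Measurable fun ω => HH s i j k N ω * (A j i).indicator 1 ω := mH.mul (mi j i)
  rw [lintegral_const_mul' _ _ (by simp), lintegral_add_right _ m2, lintegral_add_right _ m1, lintegral_const_mul _ hmG]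
  have b0 := lint_HR h0 h01 θ P hP hsd hs i j k N hk ρ hρ
  have b1 := hitA h0 h01 h2 θ P hP a (δ / 4) C hhit i j k hij hk ρ (HH s i j k N) mH (HH_upd s i j i k N)
  have b2 := hitA h0 h01 h2 θ P hP a (δ / 4) C hhit j i k (fun t ht => (hij t ht).symm) hk.symm ρ (HH s i j k N) mH (HH_upd s i j j k N)
  simp only [hRij] at b2
  set I := ∫⁻ ω, HH s i j k N ω * ENNReal.ofReal (ρ / cumR ω i k) ^ d ∂P
  calc _ ≤ (m:ℝ≥0∞) ^ 2 * (ENNReal.ofReal (2 / δ) ^ d * I + C * I + C * I) := by gcongr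
    _ = (m:ℝ≥0∞) ^ 2 * (ENNReal.ofReal (2 / δ) ^ d + C + C) * I := by ring
    _ ≤ (m:ℝ≥0∞) ^ 2 * (ENNReal.ofReal (2 / δ) ^ d + C + C) * (ENNReal.ofReal ρ ^ d * ENNReal.ofReal (m * σp ^ (s - d)) ^ k) := by gcongr
    _ = _ := by ring

lemma twopoint' (h0 : 0 < σm) (h01 : σm < σp)
    (θ : Measure (Od d)) [IsProbabilityMeasure θ]
    (P : Measure (Omega d m σm σp)) [IsProbabilityMeasure P] (hP : IsProductLaw θ P) {s : ℝ} (hs0 : 0 < s)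
    (hs : ((m : ℝ) / (σp - σm)) * (∫ r in σm..σp, r ^ s) = 1) (i j : ℕ → Fin m) (N : ℕ) (hij : ∀ t < N, i t = j t) :
    ∫⁻ ω, DE s 0 N ω i * DE s 0 N ω j ∂P ≤ ENNReal.ofReal (m * σp ^ s) ^ N := by
  have e : ∀ ω : Omega d m σm σp, DE s 0 N ω i * DE s 0 N ω j = 1 * ∏ n ∈ Finset.range N, (wtE m s (ω (pre i n))) ^ 2 := by
    intro ω
    unfold DE
    rw [one_mul, Finset.prod_pow, sq, ← Finset.range_eq_Ico]
    congr 1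
    refine Finset.prod_congr rfl fun n hn => ?_
    have := Finset.mem_range.1 hn
    rw [(pre_eq_iff i j n).2 (fun t ht => hij t (by omega))]
  simp only [e]
  have s3 := lint_prod_nodes h01 θ P hP i (fun l => wtE m s l ^ 2) ((meas_wtE m s).pow_const 2) (Finset.range N) (fun _ => 1) measurable_const (by simp)
  refine s3.le.trans ?_
  simp only [lintegral_const, measure_univ, Finset.card_range, one_mul, mul_one]
  gcongr
  exact lint_W2 h0 h01 θ hs0 hs

end twopoint

section energy
variable {d m : ℕ} {σm σp : ℝ}

lemma exists_beta (hm : 2 ≤ m) : ∃ β : Measure (ℕ → Fin m), IsProbabilityMeasure β ∧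
    ∀ (K : ℕ) (i : ℕ → Fin m), β {j | ∀ t < K, i t = j t} = ((m : ℝ≥0∞)⁻¹) ^ K := by
  haveI : Nonempty (Fin m) := ⟨⟨0, by omega⟩⟩
  let u : Measure (Fin m) := (PMF.uniformOfFintype (Fin m)).toMeasure
  refine ⟨Measure.infinitePi (fun _ => u), inferInstance, fun K i => ?_⟩
  have : {j : ℕ → Fin m | ∀ t < K, i t = j t} = Set.pi (Finset.range K : Set ℕ) (fun t => {i t}) := by
    ext j
    simp [Set.mem_pi, eq_comm]
  rw [this, Measure.infinitePi_pi]
  · have : ∀ t, u {i t} = (m:ℝ≥0∞)⁻¹ := by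
      intro t
      rw [PMF.toMeasure_apply_singleton _ _ (measurableSet_singleton _)]
      simp
    simp [this]
  · intro t _
    exact measurableSet_singleton _

def Ag (m K : ℕ) : Set ((ℕ → Fin m) × (ℕ → Fin m)) := {q | ∀ t < K, q.1 t = q.2 t}

lemma meas_Ag (K : ℕ) : MeasurableSet (Ag m K) := by
  have : Ag m K = ⋂ t ∈ Finset.range K, {q | q.1 t = q.2 t} := by ext q; simp [Ag]
  rw [this]
  refine Finset.measurableSet_biInter _ fun t _ => ?_
  exact measurableSet_eq_fun ((measurable_pi_apply t).comp measurable_fst) ((measurable_pi_apply t).comp measurable_snd)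

lemma beta_Ag (β : Measure (ℕ → Fin m)) [IsProbabilityMeasure β]
    (hβ : ∀ (K : ℕ) (i : ℕ → Fin m), β {j | ∀ t < K, i t = j t} = ((m : ℝ≥0∞)⁻¹) ^ K) (K : ℕ) :
    (β.prod β) (Ag m K) = ((m : ℝ≥0∞)⁻¹) ^ K := by
  rw [Measure.prod_apply (meas_Ag K)]
  have : ∀ i, Prod.mk i ⁻¹' (Ag m K) = {j | ∀ t < K, i t = j t} := fun i => rfl
  simp [this, hβ]

lemma meas_DE (s : ℝ) (k N : ℕ) : Measurable fun p : Omega d m σm σp × (ℕ → Fin m) => DE s k N p.1 p.2 :=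
  Finset.measurable_prod _ fun n _ => (meas_wtE m s).comp (measurable_node n)

lemma meas_U (h0 : 0 < σm) (h01 : σm < σp) (h2 : σp < 1) (a : Fin m → E d) (ρ : ℝ) :
    MeasurableSet {p : Omega d m σm σp × ((ℕ → Fin m) × (ℕ → Fin m)) | ‖piMap a p.1 p.2.1 - piMap a p.1 p.2.2‖ < ρ} := by
  have m1 : Measurable fun p : Omega d m σm σp × ((ℕ → Fin m) × (ℕ → Fin m)) => piMap a p.1 p.2.1 :=
    (measurable_pi' h0 h01 h2 a).comp (measurable_fst.prodMk (measurable_fst.comp measurable_snd))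
  have m2 : Measurable fun p : Omega d m σm σp × ((ℕ → Fin m) × (ℕ → Fin m)) => piMap a p.1 p.2.2 :=
    (measurable_pi' h0 h01 h2 a).comp (measurable_fst.prodMk (measurable_snd.comp measurable_snd))
  exact measurableSet_lt (m1.sub m2).norm measurable_const

noncomputable def FF (a : Fin m → E d) (s : ℝ) (N : ℕ) (ρ : ℝ) (p : Omega d m σm σp × ((ℕ → Fin m) × (ℕ → Fin m))) : ℝ≥0∞ :=
  DE s 0 N p.1 p.2.1 * DE s 0 N p.1 p.2.2 *
    Set.indicator {p : Omega d m σm σp × ((ℕ → Fin m) × (ℕ → Fin m)) | ‖piMap a p.1 p.2.1 - piMap a p.1 p.2.2‖ < ρ} 1 p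

lemma meas_FF (h0 : 0 < σm) (h01 : σm < σp) (h2 : σp < 1) (a : Fin m → E d) (s : ℝ) (N : ℕ) (ρ : ℝ) :
    Measurable (FF (σm := σm) (σp := σp) a s N ρ) := by
  have q1 : Measurable fun p : Omega d m σm σp × ((ℕ → Fin m) × (ℕ → Fin m)) => (p.1, p.2.1) :=
    measurable_fst.prodMk (measurable_fst.comp measurable_snd)
  have q2 : Measurable fun p : Omega d m σm σp × ((ℕ → Fin m) × (ℕ → Fin m)) => (p.1, p.2.2) :=
    measurable_fst.prodMk (measurable_snd.comp measurable_snd)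
  have m1 : Measurable fun p : Omega d m σm σp × ((ℕ → Fin m) × (ℕ → Fin m)) => DE s 0 N p.1 p.2.1 :=
    Measurable.comp (g := fun p : Omega d m σm σp × (ℕ → Fin m) => DE s 0 N p.1 p.2) (f := fun p : Omega d m σm σp × ((ℕ → Fin m) × (ℕ → Fin m)) => (p.1, p.2.1)) (meas_DE s 0 N) q1
  have m2 : Measurable fun p : Omega d m σm σp × ((ℕ → Fin m) × (ℕ → Fin m)) => DE s 0 N p.1 p.2.2 :=
    Measurable.comp (g := fun p : Omega d m σm σp × (ℕ → Fin m) => DE s 0 N p.1 p.2) (f := fun p : Omega d m σm σp × ((ℕ → Fin m) × (ℕ → Fin m)) => (p.1, p.2.2)) (meas_DE s 0 N) q2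
  exact (m1.mul m2).mul (measurable_one.indicator (meas_U h0 h01 h2 a ρ))

lemma energy (hd : 1 ≤ d) (hm : 2 ≤ m) (h0 : 0 < σm) (h01 : σm < σp) (h2 : σp < 1)
    (θ : Measure (Od d)) [IsProbabilityMeasure θ] [θ.IsMulLeftInvariant]
    (P : Measure (Omega d m σm σp)) [IsProbabilityMeasure P] (hP : IsProductLaw θ P) {s : ℝ} (hsd : (d:ℝ) < s)
    (hs : ((m : ℝ) / (σp - σm)) * (∫ r in σm..σp, r ^ s) = 1)
    (a : Fin m → E d) (ha : Function.Injective a)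
    (β : Measure (ℕ → Fin m)) [IsProbabilityMeasure β]
    (hβ : ∀ (K : ℕ) (i : ℕ → Fin m), β {j | ∀ t < K, i t = j t} = ((m : ℝ≥0∞)⁻¹) ^ K) :
    ∃ C : ℝ≥0∞, C ≠ ⊤ ∧ ∀ (N : ℕ) (ρ : ℝ), 0 < ρ →
    ∫⁻ ω, ∫⁻ q, FF a s N ρ (ω, q) ∂(β.prod β) ∂P ≤ C * ENNReal.ofReal ρ ^ d + ENNReal.ofReal (σp ^ s) ^ N := by
  obtain ⟨C, hC, htp⟩ := twopoint hd hm h0 h01 h2 θ P hP hsd hs a ha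
  have hs0 : 0 < s := lt_of_le_of_lt (Nat.cast_nonneg d) hsd
  have hp0 : 0 < σp := h0.trans h01
  have hmul : ∀ x : ℝ, ENNReal.ofReal (m * x) = m * ENNReal.ofReal x := fun x => by
    rw [ENNReal.ofReal_mul (by positivity), ENNReal.ofReal_natCast]
  have hm0 : (m:ℝ≥0∞) ≠ 0 := by
    have : m ≠ 0 := by omega
    exact_mod_cast this
  have hcancel : ∀ (x : ℝ≥0∞) (k : ℕ), (m * x) ^ k * ((m:ℝ≥0∞)⁻¹) ^ k = x ^ k := fun x k => by
    rw [← mul_pow, mul_right_comm, ENNReal.mul_inv_cancel hm0 (by simp), one_mul]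
  have hx1 : ENNReal.ofReal (σp ^ (s - d)) < 1 := by
    rw [← ENNReal.ofReal_one]
    exact (ENNReal.ofReal_lt_ofReal_iff one_pos).2 (Real.rpow_lt_one hp0.le h2 (by linarith))
  refine ⟨C * (1 - ENNReal.ofReal (σp ^ (s - d)))⁻¹, ?_, ?_⟩
  · refine ENNReal.mul_ne_top hC (ENNReal.inv_ne_top.2 ?_)
    exact (tsub_pos_of_lt hx1).ne'
  intro N ρ hρ
  rw [lintegral_lintegral_swap (by exact (meas_FF h0 h01 h2 a s N ρ).aemeasurable)]
  have hi : ∀ q : (ℕ → Fin m) × (ℕ → Fin m), Measurable fun ω : Omega d m σm σp => (ω, q) := fun i => measurable_id.prodMk measurable_const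
  have pt : ∀ q : (ℕ → Fin m) × (ℕ → Fin m), ∫⁻ ω, FF a s N ρ (ω, q) ∂P ≤ 
     ∑ k ∈ Finset.range N, (C * ENNReal.ofReal ρ ^ d * ENNReal.ofReal (m * σp ^ (s - d)) ^ k) * (Ag m k).indicator 1 q +
      ENNReal.ofReal (m * σp ^ s) ^ N * (Ag m N).indicator 1 q := by
    intro q
    by_cases hq : q ∈ Ag m N
    · rw [Set.indicator_of_mem hq]
      refine le_add_left ?_
      rw [Pi.one_apply, mul_one]
      refine le_trans (lintegral_mono fun ω => ?_) (twopoint' h0 h01 θ P hP hs0 hs q.1 q.2 N hq)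
      unfold FF
      refine (mul_le_mul_right (Set.indicator_le_self' (fun _ _ => bot_le) _) _).trans ?_
      simp
    · have : ∃ t, t < N ∧ q.1 t ≠ q.2 t := by
        by_contra h
        push Not at h
        exact hq h
      classical
      let k := Nat.find this
      have hk := Nat.find_spec this
      have hag : ∀ t < k, q.1 t = q.2 t := by
        intro t ht
        have := Nat.find_min this ht
        push Not at this
        exact this (ht.trans hk.1)
      refine le_add_right ?_
      refine le_trans ?_ (Finset.single_le_sum (fun _ _ => bot_le) (Finset.mem_range.2 hk.1))
      rw [Set.indicator_of_mem (by exact hag), Pi.one_apply, mul_one]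
      exact htp q.1 q.2 k N ρ hk.1 hρ hag hk.2
  refine (lintegral_mono pt).trans ?_
  have mi : ∀ k, Measurable ((Ag m k).indicator (1 : (ℕ → Fin m) × (ℕ → Fin m) → ℝ≥0∞)) := fun k => measurable_one.indicator (meas_Ag k)
  rw [lintegral_add_right _ ((mi N).const_mul _), lintegral_finsetSum _ (fun k _ => (mi k).const_mul _)]
  simp only [lintegral_const_mul _ (mi _), lintegral_indicator_one (meas_Ag _), beta_Ag β hβ]
  simp only [mul_assoc, hmul, hcancel]
  gcongr
  rw [← Finset.mul_sum, ← Finset.mul_sum, mul_comm _ (ENNReal.ofReal ρ ^ d)]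
  gcongr
  rw [← ENNReal.tsum_geometric]
  exact ENNReal.sum_le_tsum _

end energy

section conv
variable {d m : ℕ} {σm σp : ℝ}

noncomputable def DR (s : ℝ) (k N : ℕ) (ω : Omega d m σm σp) (i : ℕ → Fin m) : ℝ :=
  ∏ n ∈ Finset.Ico k N, wtR m s (ω (pre i n))

lemma DR_nonneg (hm : 2 ≤ m) (h0 : 0 < σm) (s : ℝ) (k N : ℕ) (ω : Omega d m σm σp) (i : ℕ → Fin m) : 0 ≤ DR s k N ω i :=
  Finset.prod_nonneg fun n _ => (wtR_pos hm h0 s _).le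

lemma DR_le (hm : 2 ≤ m) (h0 : 0 < σm) (h2 : σp < 1) {s : ℝ} (hs : 0 < s) (k N : ℕ) (ω : Omega d m σm σp) (i : ℕ → Fin m) :
    DR s k N ω i ≤ (m:ℝ) ^ (N - k) := by
  refine (Finset.prod_le_prod (fun n _ => (wtR_pos hm h0 s _).le) (fun n _ => wtR_le h0 h2 hs _)).trans ?_
  simp

lemma ofReal_DR (hm : 2 ≤ m) (h0 : 0 < σm) (s : ℝ) (k N : ℕ) (ω : Omega d m σm σp) (i : ℕ → Fin m) :
    ENNReal.ofReal (DR s k N ω i) = DE s k N ω i := 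
  ENNReal.ofReal_prod_of_nonneg fun n _ => (wtR_pos hm h0 s _).le

lemma meas_DR (s : ℝ) (k N : ℕ) : Measurable fun p : Omega d m σm σp × (ℕ → Fin m) => DR s k N p.1 p.2 :=
  Finset.measurable_prod _ fun n _ => (meas_wtR m s).comp (measurable_node n)

lemma meas_DR1 (s : ℝ) (k N : ℕ) (ω : Omega d m σm σp) : Measurable fun i : ℕ → Fin m => DR s k N ω i :=
  Measurable.comp (g := fun p : Omega d m σm σp × (ℕ → Fin m) => DR s k N p.1 p.2) (f := fun i => (ω, i)) (meas_DR s k N) 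
    (measurable_const.prodMk measurable_id)

noncomputable def gg (s : ℝ) (V : Set (ℕ → Fin m)) (k N : ℕ) (p : Omega d m σm σp × (ℕ → Fin m)) : ℝ :=
  V.indicator 1 p.2 * (DR s k N p.1 p.2 * (wtR m s (p.1 (pre p.2 N)) - 1))

lemma gg_eq (s : ℝ) (V : Set (ℕ → Fin m)) {k N : ℕ} (hkN : k ≤ N) (ω : Omega d m σm σp) (i : ℕ → Fin m) :
    gg s V k N (ω, i) = V.indicator (fun i => DR s k (N+1) ω i) i - V.indicator (fun i => DR s k N ω i) i := by
  unfold gg DR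
  by_cases hi : i ∈ V
  · simp only [Set.indicator_of_mem hi, Pi.one_apply]
    rw [Finset.prod_Ico_succ_top hkN]
    ring
  · simp [Set.indicator_of_notMem hi]

lemma meas_gg (s : ℝ) (V : Set (ℕ → Fin m)) (hV : MeasurableSet V) (k N : ℕ) : Measurable (gg (d := d) (σm := σm) (σp := σp) s V k N) := by
  have m1 : Measurable fun p : Omega d m σm σp × (ℕ → Fin m) => V.indicator (1 : (ℕ → Fin m) → ℝ) p.2 :=
    (measurable_one.indicator hV).comp measurable_snd
  have m2 : Measurable fun p : Omega d m σm σp × (ℕ → Fin m) => wtR m s (p.1 (pre p.2 N)) :=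
    (meas_wtR m s).comp (measurable_node N)
  exact m1.mul ((meas_DR s k N).mul (m2.sub_const 1))

lemma ind_abs (V : Set (ℕ → Fin m)) (i : ℕ → Fin m) : |V.indicator (1 : (ℕ → Fin m) → ℝ) i| ≤ 1 := by
  by_cases hi : i ∈ V <;> simp [hi]

lemma wt_abs (hm : 2 ≤ m) (h0 : 0 < σm) (h2 : σp < 1) {s : ℝ} (hs : 0 < s) (l : Label d σm σp) : |wtR m s l - 1| ≤ m + 1 := by
  have := wtR_pos hm h0 s l
  have := wtR_le (m := m) h0 h2 hs l
  rw [abs_le]; constructor <;> linarith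

lemma gg_abs (hm : 2 ≤ m) (h0 : 0 < σm) (h2 : σp < 1) {s : ℝ} (hs : 0 < s) (V : Set (ℕ → Fin m)) (k N : ℕ) (p : Omega d m σm σp × (ℕ → Fin m)) :
    |gg s V k N p| ≤ DR s k N p.1 p.2 * (m + 1) := by
  unfold gg
  rw [abs_mul, abs_mul, abs_of_nonneg (DR_nonneg hm h0 s k N p.1 p.2)]
  have h1 := ind_abs V p.2
  have h3 := wt_abs hm h0 h2 hs (p.1 (pre p.2 N))
  have h4 := DR_nonneg hm h0 s k N p.1 p.2
  calc _ ≤ 1 * (DR s k N p.1 p.2 * (m + 1)) := by gcongr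
    _ = _ := one_mul _

lemma gg_bdd (hm : 2 ≤ m) (h0 : 0 < σm) (h2 : σp < 1) {s : ℝ} (hs : 0 < s) (V : Set (ℕ → Fin m)) (k N : ℕ) (p : Omega d m σm σp × (ℕ → Fin m)) :
    |gg s V k N p| ≤ (m:ℝ) ^ (N - k) * (m + 1) := by
  refine (gg_abs hm h0 h2 hs V k N p).trans ?_
  gcongr
  exact DR_le hm h0 h2 hs _ _ _ _

lemma int_bdd {α : Type*} [MeasurableSpace α] (μ : Measure α) [IsFiniteMeasure μ] (f : α → ℝ) (hf : Measurable f) (C : ℝ) (h : ∀ x, |f x| ≤ C) :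
    Integrable f μ :=
  Integrable.of_bound hf.aestronglyMeasurable C (Eventually.of_forall h)

lemma DR_upd (s : ℝ) (k N : ℕ) (i v : ℕ → Fin m) (ω : Omega d m σm σp) (l) : DR s k N (Function.update ω (pre v N) l) i = DR s k N ω i := by
  refine Finset.prod_congr rfl fun n hn => ?_
  rw [Function.update_of_ne]
  intro h
  have := pre_inj _ _ h
  simp at hn
  omega

lemma pair_bd (hm : 2 ≤ m) (h0 : 0 < σm) (h01 : σm < σp) (h2 : σp < 1)
    (θ : Measure (Od d)) [IsProbabilityMeasure θ]
    (P : Measure (Omega d m σm σp)) [IsProbabilityMeasure P] (hP : IsProductLaw θ P) {s : ℝ} (hs0 : 0 < s)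
    (hs : ((m : ℝ) / (σp - σm)) * (∫ r in σm..σp, r ^ s) = 1) (V : Set (ℕ → Fin m)) (hV : MeasurableSet V) (k N : ℕ)
    (q : (ℕ → Fin m) × (ℕ → Fin m)) :
    ∫ ω, gg s V k N (ω, q.1) * gg s V k N (ω, q.2) ∂P ≤ (Ag m (N+1)).indicator (fun _ => (m + 1 : ℝ) ^ 2 * (m * σp ^ s) ^ (N - k)) q := by
  have hp0 : 0 < σp := h0.trans h01
  have hi : ∀ i : ℕ → Fin m, Measurable fun ω : Omega d m σm σp => (ω, i) := fun i => measurable_id.prodMk measurable_const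
  have mg : ∀ i, Measurable fun ω : Omega d m σm σp => gg s V k N (ω, i) := fun i => (meas_gg s V hV k N).comp (hi i)
  have hint : Integrable (fun ω => gg s V k N (ω, q.1) * gg s V k N (ω, q.2)) P := by
    refine int_bdd P _ ((mg _).mul (mg _)) (((m:ℝ) ^ (N - k) * (m + 1)) * ((m:ℝ) ^ (N - k) * (m + 1))) fun ω => ?_
    rw [abs_mul]
    gcongr <;> exact gg_bdd hm h0 h2 hs0 V k N _
  by_cases hq : q ∈ Ag m (N+1)
  · rw [Set.indicator_of_mem hq]
    have mD : Measurable fun ω : Omega d m σm σp => DR s k N ω q.1 := 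
      Measurable.comp (g := fun p : Omega d m σm σp × (ℕ → Fin m) => DR s k N p.1 p.2) (f := fun ω => (ω, q.1)) (meas_DR s k N) (hi _)
    have iD : Integrable (fun ω => (m + 1 : ℝ) ^ 2 * DR s k N ω q.1 ^ 2) P := by
      refine (int_bdd P _ (mD.pow_const 2) (((m:ℝ) ^ (N - k)) ^ 2) fun ω => ?_).const_mul _
      have := DR_nonneg hm h0 s k N ω q.1
      rw [abs_pow, abs_of_nonneg this]
      gcongr
      exact DR_le hm h0 h2 hs0 _ _ _ _
    have hDq : ∀ ω : Omega d m σm σp, DR s k N ω q.2 = DR s k N ω q.1 := fun ω => Finset.prod_congr rfl fun n hn => by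
      have := (Finset.mem_Ico.1 hn).2
      rw [(pre_eq_iff q.1 q.2 n).2 (fun t ht => hq t (by omega))]
    calc ∫ ω, gg s V k N (ω, q.1) * gg s V k N (ω, q.2) ∂P ≤ ∫ ω, (m + 1 : ℝ) ^ 2 * DR s k N ω q.1 ^ 2 ∂P := by
          refine integral_mono hint iD fun ω => ?_
          have e1 := gg_abs hm h0 h2 hs0 V k N (ω, q.1)
          have e2 := gg_abs hm h0 h2 hs0 V k N (ω, q.2)
          simp only [hDq] at e1 e2
          calc _ ≤ |gg s V k N (ω, q.1) * gg s V k N (ω, q.2)| := le_abs_self _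
            _ = |gg s V k N (ω, q.1)| * |gg s V k N (ω, q.2)| := abs_mul _ _
            _ ≤ (DR s k N ω q.1 * (m + 1)) * (DR s k N ω q.1 * (m + 1)) := by
              have := DR_nonneg hm h0 s k N ω q.1
              gcongr
            _ = _ := by ring
      _ = (m + 1 : ℝ) ^ 2 * ∫ ω, DR s k N ω q.1 ^ 2 ∂P := integral_const_mul _ _
      _ ≤ _ := by
        gcongr
        rw [integral_eq_lintegral_of_nonneg_ae (Eventually.of_forall fun ω => sq_nonneg _) (mD.pow_const 2).aestronglyMeasurable]
        apply ENNReal.toReal_le_of_le_ofReal (by positivity)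
        have e : ∀ ω : Omega d m σm σp, ENNReal.ofReal (DR s k N ω q.1 ^ 2) = 1 * ∏ n ∈ Finset.Ico k N, (wtE m s (ω (pre q.1 n))) ^ 2 := by
          intro ω
          rw [ENNReal.ofReal_pow (DR_nonneg hm h0 s k N ω q.1), ofReal_DR hm h0, DE, Finset.prod_pow, one_mul]
        simp only [e]
        have s3 := lint_prod_nodes h01 θ P hP q.1 (fun l => wtE m s l ^ 2) ((meas_wtE m s).pow_const 2) (Finset.Ico k N) (fun _ => 1) measurable_const (by simp)
        refine s3.le.trans ?_
        rw [ENNReal.ofReal_pow (by positivity)]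
        simp only [lintegral_const, measure_univ, Nat.card_Ico, one_mul, mul_one]
        gcongr
        exact lint_W2 h0 h01 θ hs0 hs
  · rw [Set.indicator_of_notMem hq]
    haveI := labelM_prob h01 θ
    have hne : pre q.2 N ≠ pre q.1 N := by
      intro h
      exact hq fun t ht => (((pre_eq_iff q.2 q.1 N).1 h) t (by omega)).symm
    have mD : Measurable fun ω : Omega d m σm σp => DR s k N ω q.1 := 
      Measurable.comp (g := fun p : Omega d m σm σp × (ℕ → Fin m) => DR s k N p.1 p.2) (f := fun ω => (ω, q.1)) (meas_DR s k N) (hi _)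
    have e : ∀ ω : Omega d m σm σp, gg s V k N (ω, q.1) * gg s V k N (ω, q.2) =
       (V.indicator 1 q.1 * DR s k N ω q.1 * gg s V k N (ω, q.2)) * (wtR m s (ω (pre q.1 N)) - 1) := by
      intro ω
      simp only [gg]
      ring
    have := int_zero h01 θ P hP (pre q.1 N) (fun ω => V.indicator 1 q.1 * DR s k N ω q.1 * gg s V k N (ω, q.2)) (fun l => wtR m s l - 1)
      ((mD.const_mul _).mul (mg _)) ((meas_wtR m s).sub_const 1) (by
        intro ω l
        simp only [gg, DR_upd, Function.update_of_ne hne]) (by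
        rw [integral_sub (int_bdd _ _ (meas_wtR m s) m fun l => by
          rw [abs_of_nonneg (wtR_pos hm h0 s l).le]; exact wtR_le h0 h2 hs0 l) (integrable_const _), int_wtR hm h0 h01 θ hs]
        simp) (by simpa only [e] using hint)
    simp only [e]
    exact this.le

lemma incr2 (hm : 2 ≤ m) (h0 : 0 < σm) (h01 : σm < σp) (h2 : σp < 1)
    (θ : Measure (Od d)) [IsProbabilityMeasure θ]
    (P : Measure (Omega d m σm σp)) [IsProbabilityMeasure P] (hP : IsProductLaw θ P) {s : ℝ} (hs0 : 0 < s)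
    (hs : ((m : ℝ) / (σp - σm)) * (∫ r in σm..σp, r ^ s) = 1)
    (β : Measure (ℕ → Fin m)) [IsProbabilityMeasure β]
    (hβ : ∀ (K : ℕ) (i : ℕ → Fin m), β {j | ∀ t < K, i t = j t} = ((m : ℝ≥0∞)⁻¹) ^ K)
    (V : Set (ℕ → Fin m)) (hV : MeasurableSet V) (k N : ℕ) (hkN : k ≤ N) :
    ∫ ω, (∫ i, gg s V k N (ω, i) ∂β) ^ 2 ∂P ≤ (m + 1 : ℝ) ^ 2 * ((m : ℝ)⁻¹) ^ k * (σp ^ s) ^ (N - k) := by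
  have hp0 : 0 < σp := h0.trans h01
  have hm0 : (1:ℝ) < m := by exact_mod_cast (by omega : 1 < m)
  have mg := meas_gg (d := d) (σm := σm) (σp := σp) s V hV k N
  have q1 : Measurable fun p : Omega d m σm σp × ((ℕ → Fin m) × (ℕ → Fin m)) => (p.1, p.2.1) :=
    measurable_fst.prodMk (measurable_fst.comp measurable_snd)
  have q2 : Measurable fun p : Omega d m σm σp × ((ℕ → Fin m) × (ℕ → Fin m)) => (p.1, p.2.2) :=
    measurable_fst.prodMk (measurable_snd.comp measurable_snd)
  have hint : Integrable (fun p : Omega d m σm σp × ((ℕ → Fin m) × (ℕ → Fin m)) => gg s V k N (p.1, p.2.1) * gg s V k N (p.1, p.2.2)) (P.prod (β.prod β)) := by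
    refine int_bdd _ _ ((mg.comp q1).mul (mg.comp q2)) (((m:ℝ) ^ (N - k) * (m + 1)) * ((m:ℝ) ^ (N - k) * (m + 1))) fun ω => ?_
    rw [abs_mul]
    gcongr <;> exact gg_bdd hm h0 h2 hs0 V k N _
  have e : ∀ ω : Omega d m σm σp, (∫ i, gg s V k N (ω, i) ∂β) ^ 2 = ∫ q, gg s V k N (ω, q.1) * gg s V k N (ω, q.2) ∂(β.prod β) := by
    intro ω
    rw [sq]
    exact (integral_prod_mul (fun i => gg s V k N (ω, i)) (fun i => gg s V k N (ω, i))).symm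
  simp only [e]
  rw [integral_integral_swap (by exact hint)]
  calc _ ≤ ∫ q, (Ag m (N+1)).indicator (fun _ => (m + 1 : ℝ) ^ 2 * (m * σp ^ s) ^ (N - k)) q ∂(β.prod β) := by
        refine integral_mono ?_ ?_ (fun q => pair_bd hm h0 h01 h2 θ P hP hs0 hs V hV k N q)
        · exact hint.integral_prod_right
        · exact (integrable_const _).indicator (meas_Ag _)
    _ = ((m:ℝ)⁻¹) ^ (N+1) * ((m + 1 : ℝ) ^ 2 * (m * σp ^ s) ^ (N - k)) := by
      rw [integral_indicator_const _ (meas_Ag _), Measure.real, beta_Ag β hβ]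
      simp
    _ ≤ ((m:ℝ)⁻¹) ^ N * ((m + 1 : ℝ) ^ 2 * (m * σp ^ s) ^ (N - k)) := by
      gcongr ?_ * _
      exact pow_le_pow_of_le_one (by positivity) (inv_le_one_of_one_le₀ hm0.le) (Nat.le_succ N)
    _ = _ := by
      obtain ⟨r, rfl⟩ := Nat.exists_eq_add_of_le hkN
      rw [Nat.add_sub_cancel_left, pow_add, mul_pow, inv_pow, inv_pow]
      field_simp

lemma incr1 (hm : 2 ≤ m) (h0 : 0 < σm) (h01 : σm < σp) (h2 : σp < 1)
    (θ : Measure (Od d)) [IsProbabilityMeasure θ]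
    (P : Measure (Omega d m σm σp)) [IsProbabilityMeasure P] (hP : IsProductLaw θ P) {s : ℝ} (hs0 : 0 < s)
    (hs : ((m : ℝ) / (σp - σm)) * (∫ r in σm..σp, r ^ s) = 1)
    (β : Measure (ℕ → Fin m)) [IsProbabilityMeasure β]
    (hβ : ∀ (K : ℕ) (i : ℕ → Fin m), β {j | ∀ t < K, i t = j t} = ((m : ℝ≥0∞)⁻¹) ^ K)
    (V : Set (ℕ → Fin m)) (hV : MeasurableSet V) (k n : ℕ) :
    ∫⁻ ω, ENNReal.ofReal |∫ i, gg s V k (k + n) (ω, i) ∂β| ∂P ≤ ENNReal.ofReal ((m + 1 : ℝ) * (√(m : ℝ)⁻¹) ^ k * (√(σp ^ s)) ^ n) := by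
  have hp0 : 0 < σp := h0.trans h01
  have hm0 : (1:ℝ) < m := by exact_mod_cast (by omega : 1 < m)
  have mg := meas_gg (d := d) (σm := σm) (σp := σp) s V hV k (k + n)
  have mX : Measurable fun ω : Omega d m σm σp => ∫ i, gg s V k (k + n) (ω, i) ∂β :=
    (mg.stronglyMeasurable.integral_prod_right' (ν := β)).measurable
  have bX : ∀ ω : Omega d m σm σp, |∫ i, gg s V k (k + n) (ω, i) ∂β| ≤ (m:ℝ) ^ (k + n - k) * (m + 1) := fun ω => by
    have := norm_integral_le_of_norm_le_const (μ := β) (f := fun i => gg s V k (k + n) (ω, i)) (Eventually.of_forall fun i => gg_bdd hm h0 h2 hs0 V k (k + n) (ω, i))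
    simpa using this
  set t := (m + 1 : ℝ) * (√(m : ℝ)⁻¹) ^ k * (√(σp ^ s)) ^ n with ht
  have tpos : 0 < t := by positivity
  have i1 : Integrable (fun ω => |∫ i, gg s V k (k + n) (ω, i) ∂β|) P := (int_bdd P _ mX _ bX).abs
  have i2 : Integrable (fun ω => (∫ i, gg s V k (k + n) (ω, i) ∂β) ^ 2) P := int_bdd P _ (mX.pow_const 2) (((m:ℝ) ^ (k + n - k) * (m + 1)) ^ 2) fun ω => by
    rw [abs_pow]; gcongr; exact bX ω
  rw [← ofReal_integral_eq_lintegral_ofReal i1 (Eventually.of_forall fun _ => abs_nonneg _)]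
  apply ENNReal.ofReal_le_ofReal
  have b2 := incr2 hm h0 h01 h2 θ P hP hs0 hs β hβ V hV k (k + n) (by omega)
  have et : (m + 1 : ℝ) ^ 2 * ((m : ℝ)⁻¹) ^ k * (σp ^ s) ^ (k + n - k) = t ^ 2 := by
    rw [ht, Nat.add_sub_cancel_left, mul_pow, mul_pow, ← pow_mul, ← pow_mul, mul_comm k 2, mul_comm n 2, pow_mul, pow_mul, Real.sq_sqrt (by positivity), Real.sq_sqrt (by positivity)]
  rw [et] at b2
  calc _ ≤ ∫ ω, (t / 2 + (∫ i, gg s V k (k + n) (ω, i) ∂β) ^ 2 / (2 * t)) ∂P := by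
        refine integral_mono i1 ((integrable_const _).add (i2.div_const _)) fun ω => ?_
        show |∫ i, gg s V k (k + n) (ω, i) ∂β| ≤ t / 2 + (∫ i, gg s V k (k + n) (ω, i) ∂β) ^ 2 / (2 * t)
        rw [← sq_abs (∫ i, gg s V k (k + n) (ω, i) ∂β)]
        generalize |∫ i, gg s V k (k + n) (ω, i) ∂β| = x
        rw [div_add_div _ _ (by norm_num) (by positivity), le_div_iff₀ (by positivity)]
        nlinarith [sq_nonneg (t - x)]
    _ = t / 2 + (∫ ω, (∫ i, gg s V k (k + n) (ω, i) ∂β) ^ 2 ∂P) / (2 * t) := by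
        rw [integral_add (integrable_const _) (i2.div_const _), integral_div (2 * t) (fun ω => (∫ i, gg s V k (k + n) (ω, i) ∂β) ^ 2)]
        simp
    _ ≤ t / 2 + t ^ 2 / (2 * t) := by gcongr
    _ = t := by field_simp; ring

lemma incr_sum (hm : 2 ≤ m) (h0 : 0 < σm) (h01 : σm < σp) (h2 : σp < 1)
    (θ : Measure (Od d)) [IsProbabilityMeasure θ]
    (P : Measure (Omega d m σm σp)) [IsProbabilityMeasure P] (hP : IsProductLaw θ P) {s : ℝ} (hs0 : 0 < s)
    (hs : ((m : ℝ) / (σp - σm)) * (∫ r in σm..σp, r ^ s) = 1)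
    (β : Measure (ℕ → Fin m)) [IsProbabilityMeasure β]
    (hβ : ∀ (K : ℕ) (i : ℕ → Fin m), β {j | ∀ t < K, i t = j t} = ((m : ℝ≥0∞)⁻¹) ^ K)
    (V : Set (ℕ → Fin m)) (hV : MeasurableSet V) (k : ℕ) :
    ∫⁻ ω, ∑' n, ENNReal.ofReal |∫ i, gg s V k (k + n) (ω, i) ∂β| ∂P ≤ ENNReal.ofReal (((m + 1 : ℝ) * (1 - √(σp ^ s))⁻¹) * (√(m : ℝ)⁻¹) ^ k) := by
  have hp0 : 0 < σp := h0.trans h01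
  have hq1 : √(σp ^ s) < 1 := by
    rw [Real.sqrt_lt' one_pos, one_pow]
    exact Real.rpow_lt_one hp0.le h2 hs0
  have mX : ∀ n, Measurable fun ω : Omega d m σm σp => ∫ i, gg s V k (k + n) (ω, i) ∂β := fun n =>
    ((meas_gg (d := d) (σm := σm) (σp := σp) s V hV k (k + n)).stronglyMeasurable.integral_prod_right' (ν := β)).measurable
  have mX2 : ∀ n, Measurable fun ω : Omega d m σm σp => ENNReal.ofReal |∫ i, gg s V k (k + n) (ω, i) ∂β| := fun n => 
    (continuous_abs.measurable.comp (mX n)).ennreal_ofReal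
  rw [lintegral_tsum fun n => (mX2 n).aemeasurable]
  refine (ENNReal.tsum_le_tsum fun n => incr1 hm h0 h01 h2 θ P hP hs0 hs β hβ V hV k n).trans ?_
  have hg := summable_geometric_of_lt_one (Real.sqrt_nonneg (σp ^ s)) hq1
  rw [← ENNReal.ofReal_tsum_of_nonneg (fun n => by positivity) (hg.mul_left _), tsum_mul_left, tsum_geometric_of_lt_one (Real.sqrt_nonneg (σp ^ s)) hq1]
  apply le_of_eq
  congr 1
  ring

end conv

section conv2
variable {d m : ℕ} {σm σp : ℝ}

lemma int_DR (hm : 2 ≤ m) (h0 : 0 < σm) (h2 : σp < 1) {s : ℝ} (hs : 0 < s) (β : Measure (ℕ → Fin m)) [IsProbabilityMeasure β]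
    (k N : ℕ) (ω : Omega d m σm σp) : Integrable (fun i => DR s k N ω i) β :=
  int_bdd β _ (meas_DR1 s k N ω) ((m:ℝ) ^ (N - k)) fun i => by
    rw [abs_of_nonneg (DR_nonneg hm h0 s k N ω i)]; exact DR_le hm h0 h2 hs k N ω i

lemma gg_int (hm : 2 ≤ m) (h0 : 0 < σm) (h2 : σp < 1) {s : ℝ} (hs : 0 < s) (β : Measure (ℕ → Fin m)) [IsProbabilityMeasure β]
    (V : Set (ℕ → Fin m)) (hV : MeasurableSet V) {k N : ℕ} (hkN : k ≤ N) (ω : Omega d m σm σp) :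
    ∫ i, gg s V k N (ω, i) ∂β = ∫ i in V, DR s k (N+1) ω i ∂β - ∫ i in V, DR s k N ω i ∂β := by
  simp only [gg_eq s V hkN]
  rw [integral_sub ((int_DR hm h0 h2 hs β _ _ ω).indicator hV) ((int_DR hm h0 h2 hs β _ _ ω).indicator hV),
    integral_indicator hV, integral_indicator hV]

lemma conv_ae (hm : 2 ≤ m) (h0 : 0 < σm) (h01 : σm < σp) (h2 : σp < 1)
    (θ : Measure (Od d)) [IsProbabilityMeasure θ]
    (P : Measure (Omega d m σm σp)) [IsProbabilityMeasure P] (hP : IsProductLaw θ P) {s : ℝ} (hs0 : 0 < s)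
    (hs : ((m : ℝ) / (σp - σm)) * (∫ r in σm..σp, r ^ s) = 1)
    (β : Measure (ℕ → Fin m)) [IsProbabilityMeasure β]
    (hβ : ∀ (K : ℕ) (i : ℕ → Fin m), β {j | ∀ t < K, i t = j t} = ((m : ℝ≥0∞)⁻¹) ^ K)
    (V : Set (ℕ → Fin m)) (hV : MeasurableSet V) :
    ∀ᵐ ω ∂P, ∃ L : ℝ, Tendsto (fun N => ∫ i in V, DR s 0 N ω i ∂β) atTop (𝓝 L) := by
  have hsum := incr_sum hm h0 h01 h2 θ P hP hs0 hs β hβ V hV 0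
  have mX2 : ∀ n, Measurable fun ω : Omega d m σm σp => ENNReal.ofReal |∫ i, gg s V 0 (0 + n) (ω, i) ∂β| := fun n => 
    (continuous_abs.measurable.comp ((meas_gg (d := d) (σm := σm) (σp := σp) s V hV 0 (0 + n)).stronglyMeasurable.integral_prod_right' (ν := β)).measurable).ennreal_ofReal
  have hfin := ae_lt_top (Measurable.ennreal_tsum mX2) (ne_top_of_le_ne_top ENNReal.ofReal_ne_top hsum)
  filter_upwards [hfin] with ω hω
  have hsm : Summable fun n => |∫ i, gg s V 0 (0 + n) (ω, i) ∂β| := by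
    have := ENNReal.summable_toReal hω.ne
    simpa [ENNReal.toReal_ofReal, abs_nonneg] using this
  have hc : CauchySeq (fun N => ∫ i in V, DR s 0 N ω i ∂β) := by
    apply cauchySeq_of_summable_dist
    refine hsm.congr fun n => ?_
    rw [gg_int hm h0 h2 hs0 β V hV (by omega), Real.dist_eq, abs_sub_comm, zero_add]
  exact cauchySeq_tendsto_of_complete hc

lemma pos_ae (hm : 2 ≤ m) (h0 : 0 < σm) (h01 : σm < σp) (h2 : σp < 1)
    (θ : Measure (Od d)) [IsProbabilityMeasure θ]
    (P : Measure (Omega d m σm σp)) [IsProbabilityMeasure P] (hP : IsProductLaw θ P) {s : ℝ} (hs0 : 0 < s)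
    (hs : ((m : ℝ) / (σp - σm)) * (∫ r in σm..σp, r ^ s) = 1)
    (β : Measure (ℕ → Fin m)) [IsProbabilityMeasure β]
    (hβ : ∀ (K : ℕ) (i : ℕ → Fin m), β {j | ∀ t < K, i t = j t} = ((m : ℝ≥0∞)⁻¹) ^ K) :
    ∀ᵐ ω ∂P, ∃ c : ℝ, 0 < c ∧ ∃ k, ∀ N ≥ k, c ≤ ∫ i, DR s 0 N ω i ∂β := by
  let S : ℕ → Omega d m σm σp → ℝ≥0∞ := fun k ω => ∑' n, ENNReal.ofReal |∫ i, gg s Set.univ k (k + n) (ω, i) ∂β|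
  have mS : ∀ k, Measurable (S k) := fun k => Measurable.ennreal_tsum fun n => 
    (continuous_abs.measurable.comp ((meas_gg (d := d) (σm := σm) (σp := σp) s Set.univ MeasurableSet.univ k (k + n)).stronglyMeasurable.integral_prod_right' (ν := β)).measurable).ennreal_ofReal
  set K := ((m + 1 : ℝ) * (1 - √(σp ^ s))⁻¹) with hK
  have hm0 : (1:ℝ) < m := by exact_mod_cast (by omega : 1 < m)
  have hu : √(m : ℝ)⁻¹ < 1 := by
    rw [Real.sqrt_lt' one_pos, one_pow]
    exact inv_lt_one_of_one_lt₀ hm0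
  have hmark : ∀ k, P {ω | 2⁻¹ ≤ S k ω} ≤ ENNReal.ofReal (K * (√(m : ℝ)⁻¹) ^ k) / 2⁻¹ := by
    intro k
    refine (meas_ge_le_lintegral_div (mS k).aemeasurable (by simp) (by simp)).trans ?_
    gcongr
    exact incr_sum hm h0 h01 h2 θ P hP hs0 hs β hβ Set.univ MeasurableSet.univ k
  have hlim : Tendsto (fun k => ENNReal.ofReal (K * (√(m : ℝ)⁻¹) ^ k) / 2⁻¹) atTop (𝓝 0) := by
    have h1 : Tendsto (fun k : ℕ => K * (√(m : ℝ)⁻¹) ^ k) atTop (𝓝 0) := by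
      simpa using (tendsto_pow_atTop_nhds_zero_of_lt_one (Real.sqrt_nonneg _) hu).const_mul K
    have h3 := ENNReal.Tendsto.div_const (ENNReal.tendsto_ofReal h1) (b := 2⁻¹) (Or.inr (by simp))
    simpa using h3
  have hnull : P {ω | ∀ k, 2⁻¹ ≤ S k ω} = 0 := by
    refine le_antisymm (ge_of_tendsto' hlim fun k => ?_) bot_le
    exact (measure_mono (show {ω | ∀ k, 2⁻¹ ≤ S k ω} ⊆ {ω | 2⁻¹ ≤ S k ω} from fun ω hω => hω k)).trans (hmark k)
  have hae : ∀ᵐ ω ∂P, ¬ ∀ k, 2⁻¹ ≤ S k ω := by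
    rw [ae_iff]; simpa using hnull
  filter_upwards [hae] with ω hω
  push Not at hω
  obtain ⟨k, hk⟩ := hω
  have hp : 0 < (m:ℝ) * σm ^ s := by positivity
  refine ⟨((m:ℝ) * σm ^ s) ^ k * (1 / 2), by positivity, k, fun N hN => ?_⟩
  obtain ⟨n, rfl⟩ := Nat.exists_eq_add_of_le hN
  have hZ : |∫ i, DR s k (k + n) ω i ∂β - 1| ≤ 1 / 2 := by
    have e : ∫ i, DR s k (k + n) ω i ∂β - 1 = ∑ t ∈ Finset.range n, ∫ i, gg s Set.univ k (k + t) (ω, i) ∂β := by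
      have : ∀ t, ∫ i, gg s Set.univ k (k + t) (ω, i) ∂β = (fun t => ∫ i, DR s k (k + t) ω i ∂β) (t+1) - (fun t => ∫ i, DR s k (k + t) ω i ∂β) t := fun t => by
        rw [gg_int hm h0 h2 hs0 β Set.univ MeasurableSet.univ (by omega)]
        simp [add_assoc]
      simp only [this]
      rw [Finset.sum_range_sub (fun t => ∫ i, DR s k (k + t) ω i ∂β)]
      simp [DR]
    rw [e]
    refine (Finset.abs_sum_le_sum_abs _ _).trans ?_
    have h5 : ENNReal.ofReal (∑ t ∈ Finset.range n, |∫ i, gg s Set.univ k (k + t) (ω, i) ∂β|) ≤ ENNReal.ofReal (1 / 2) := by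
      rw [ENNReal.ofReal_sum_of_nonneg fun _ _ => abs_nonneg _]
      refine (ENNReal.sum_le_tsum _).trans (hk.le.trans ?_)
      rw [one_div, ENNReal.ofReal_inv_of_pos two_pos]; simp
    exact (ENNReal.ofReal_le_ofReal_iff (by norm_num)).1 h5
  have hZ' : 1 / 2 ≤ ∫ i, DR s k (k + n) ω i ∂β := by
    have := (abs_le.1 hZ).1
    linarith
  calc ((m:ℝ) * σm ^ s) ^ k * (1 / 2) ≤ ((m:ℝ) * σm ^ s) ^ k * ∫ i, DR s k (k + n) ω i ∂β := by gcongr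
    _ = ∫ i, ((m:ℝ) * σm ^ s) ^ k * DR s k (k + n) ω i ∂β := (integral_const_mul _ _).symm
    _ ≤ _ := by
      refine integral_mono ((int_DR hm h0 h2 hs0 β _ _ ω).const_mul _) (int_DR hm h0 h2 hs0 β _ _ ω) fun i => ?_
      have e : DR s 0 (k + n) ω i = DR s 0 k ω i * DR s k (k + n) ω i := (Finset.prod_Ico_consecutive _ (Nat.zero_le k) hN).symm
      show _ ≤ DR s 0 (k + n) ω i
      rw [e]
      refine mul_le_mul_of_nonneg_right ?_ (DR_nonneg hm h0 s _ _ ω i)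
      calc ((m:ℝ) * σm ^ s) ^ k = ∏ n ∈ Finset.Ico 0 k, ((m:ℝ) * σm ^ s) := by simp
        _ ≤ _ := Finset.prod_le_prod (fun _ _ => hp.le) fun n _ => by
          unfold wtR
          gcongr
          exact (ω (pre i n)).1.2.1.le

end conv2

section absm
variable {m : ℕ}

lemma isClopen_cyl {k : ℕ} (w : Fin k → Fin m) : IsClopen (cyl w) := by
  have : cyl w = ⋂ t : Fin k, (fun j : ℕ → Fin m => j t.1) ⁻¹' {w t} := by
    ext j; simp [cyl]
  rw [this]
  refine isClopen_iInter_of_finite fun t => ?_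
  exact (isClopen_discrete _).preimage (continuous_apply _)

lemma meas_cyl {k : ℕ} (w : Fin k → Fin m) : MeasurableSet (cyl w) :=
  (isClopen_cyl w).isOpen.measurableSet

lemma exists_limit (hm : 2 ≤ m) (ν : ℕ → Measure (ℕ → Fin m)) (hν : ∀ N, IsFiniteMeasure (ν N))
    (L : ∀ k, (Fin k → Fin m) → ℝ≥0∞) (hL : ∀ k w, L k w ≠ ⊤)
    (h : ∀ k (w : Fin k → Fin m), Tendsto (fun N => ν N (cyl w)) atTop (𝓝 (L k w))) :
    ∃ μ : Measure (ℕ → Fin m), IsFiniteMeasure μ ∧ ∀ k w, μ (cyl w) = L k w := by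
  haveI : Nonempty (Fin m) := ⟨⟨0, by omega⟩⟩
  have hu : ∀ w : Fin 0 → Fin m, cyl w = Set.univ := fun w => by ext j; simp [cyl]
  let e : Fin 0 → Fin m := Fin.elim0
  have hT := h 0 e
  rw [hu] at hT
  have hle : ∀ k w, L k w ≤ L 0 e := fun k w =>
    le_of_tendsto_of_tendsto' (h k w) hT fun N => measure_mono (Set.subset_univ _)
  by_cases h0 : L 0 e = 0
  · refine ⟨0, inferInstance, fun k w => ?_⟩
    have := hle k w
    rw [h0] at this
    simpa using (le_antisymm this bot_le).symm
  let U : Ultrafilter ℕ := Filter.hyperfilter ℕ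
  have hU : (U : Filter ℕ) ≤ atTop := by
    rw [← Nat.cofinite_eq_atTop]; exact Filter.hyperfilter_le_cofinite
  let fm : ℕ → FiniteMeasure (ℕ → Fin m) := fun N => ⟨ν N, hν N⟩
  let p : ℕ → ProbabilityMeasure (ℕ → Fin m) := fun N => (fm N).normalize
  obtain ⟨q, -, hq⟩ := isCompact_univ.ultrafilter_le_nhds' (U.map p) (Filter.univ_mem (f := ((U.map p : Ultrafilter _) : Filter (ProbabilityMeasure (ℕ → Fin m)))))
  have hq' : Tendsto p U (𝓝 q) := hq
  refine ⟨L 0 e • (q : Measure (ℕ → Fin m)), ?_, fun k w => ?_⟩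
  · exact ⟨by simpa using (hL 0 e).lt_top⟩
  have t1 := ProbabilityMeasure.tendsto_measure_of_null_frontier_of_tendsto' hq' (E := cyl w)
    (by simp [(isClopen_cyl w).frontier_eq])
  have t2 : Tendsto (fun N => ν N Set.univ * (p N : Measure (ℕ → Fin m)) (cyl w)) U
      (𝓝 (L 0 e * (q : Measure (ℕ → Fin m)) (cyl w))) :=
    ENNReal.Tendsto.mul (hT.mono_left hU) (Or.inl h0) t1 (Or.inr (hL 0 e))
  have t3 := (h k w).mono_left hU
  have ev : ∀ N, ν N (cyl w) = ν N Set.univ * (p N : Measure (ℕ → Fin m)) (cyl w) := by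
    intro N
    by_cases hz : fm N = 0
    · have : ν N = 0 := congrArg (fun x : FiniteMeasure (ℕ → Fin m) => (x : Measure (ℕ → Fin m))) hz
      simp [this]
    · show _ = _ * ((fm N).normalize : Measure (ℕ → Fin m)) (cyl w)
      have hmass := FiniteMeasure.self_eq_mass_mul_normalize (fm N) (cyl w)
      have := congrArg (fun x : NNReal => (x : ℝ≥0∞)) hmass
      have hms : ((fm N).mass : ℝ≥0∞) = ν N Set.univ := FiniteMeasure.ennreal_mass
      rw [← hms]
      simpa [FiniteMeasure.ennreal_coeFn_eq_coeFn_toMeasure, fm] using this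
  simp only [ev] at t3
  simpa using tendsto_nhds_unique t2 t3

/-- set of pairs covered by level K products inside O -/
def RK (O : Set ((ℕ → Fin m) × (ℕ → Fin m))) (K : ℕ) : Set ((ℕ → Fin m) × (ℕ → Fin m)) :=
  ⋃ x ∈ {x : (Fin K → Fin m) × (Fin K → Fin m) | cyl x.1 ×ˢ cyl x.2 ⊆ O}, cyl x.1 ×ˢ cyl x.2

lemma mem_RK (O : Set ((ℕ → Fin m) × (ℕ → Fin m))) (K : ℕ) (q) :
    q ∈ RK O K ↔ ∀ q' : (ℕ → Fin m) × (ℕ → Fin m), (∀ t < K, q'.1 t = q.1 t) → (∀ t < K, q'.2 t = q.2 t) → q' ∈ O := by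
  unfold RK
  simp only [Set.mem_iUnion, Set.mem_setOf_eq, exists_prop, Set.mem_prod]
  constructor
  · rintro ⟨x, hx, h1, h2⟩ q' g1 g2
    exact hx ⟨fun t => (g1 t t.2).trans (h1 t), fun t => (g2 t t.2).trans (h2 t)⟩
  · intro h
    refine ⟨(fun t => q.1 t, fun t => q.2 t), ?_, fun t => rfl, fun t => rfl⟩
    rintro q' ⟨h1, h2⟩
    exact h q' (fun t ht => h1 ⟨t, ht⟩) (fun t ht => h2 ⟨t, ht⟩)

lemma RK_mono (O : Set ((ℕ → Fin m) × (ℕ → Fin m))) : Monotone (RK O) := by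
  intro K K' h q hq
  rw [mem_RK] at hq ⊢
  exact fun q' h1 h2 => hq q' (fun t ht => h1 t (ht.trans_le h)) (fun t ht => h2 t (ht.trans_le h))

lemma RK_union (O : Set ((ℕ → Fin m) × (ℕ → Fin m))) (hO : IsOpen O) : ⋃ K, RK O K = O := by
  ext q
  simp only [Set.mem_iUnion, mem_RK]
  constructor
  · rintro ⟨K, h⟩
    exact h q (fun _ _ => rfl) (fun _ _ => rfl)
  · intro hq
    by_contra hcon
    push Not at hcon
    choose f f1 f2 f3 using hcon
    have c : Tendsto f atTop (𝓝 q) := by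
      rw [show q = (q.1, q.2) from rfl, nhds_prod_eq]
      refine Tendsto.prodMk (f := atTop) (g := 𝓝 q.1) (h := 𝓝 q.2) (m₁ := fun K => (f K).1) (m₂ := fun K => (f K).2) ?_ ?_
      · refine tendsto_pi_nhds.2 fun t => tendsto_const_nhds.congr' ?_
        filter_upwards [eventually_gt_atTop t] with K hK using (f1 K t hK).symm
      · refine tendsto_pi_nhds.2 fun t => tendsto_const_nhds.congr' ?_
        filter_upwards [eventually_gt_atTop t] with K hK using (f2 K t hK).symm
    obtain ⟨K, hK⟩ := (c.eventually (hO.mem_nhds hq)).exists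
    exact f3 K hK

lemma RK_meas (O : Set ((ℕ → Fin m) × (ℕ → Fin m))) (K : ℕ) (ν : Measure (ℕ → Fin m)) [IsFiniteMeasure ν] :
    (ν.prod ν) (RK O K) = ∑ x ∈ (Set.toFinite {x : (Fin K → Fin m) × (Fin K → Fin m) | cyl x.1 ×ˢ cyl x.2 ⊆ O}).toFinset,
      ν (cyl x.1) * ν (cyl x.2) := by
  classical
  have : RK O K = ⋃ x ∈ (Set.toFinite {x : (Fin K → Fin m) × (Fin K → Fin m) | cyl x.1 ×ˢ cyl x.2 ⊆ O}).toFinset, cyl x.1 ×ˢ cyl x.2 := by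
    simp [RK]
  rw [this, measure_biUnion_finset]
  · simp only [Measure.prod_prod]
  · intro x _ y _ hxy
    refine Set.disjoint_left.2 fun q hq hq' => hxy ?_
    refine Prod.ext (funext fun t => ?_) (funext fun t => ?_)
    · exact (hq.1 t).symm.trans (hq'.1 t)
    · exact (hq.2 t).symm.trans (hq'.2 t)
  · exact fun x _ => (meas_cyl _).prod (meas_cyl _)

lemma lsc (ν : ℕ → Measure (ℕ → Fin m)) (hν : ∀ N, IsFiniteMeasure (ν N))
    (μ : Measure (ℕ → Fin m)) [IsFiniteMeasure μ]
    (h : ∀ k (w : Fin k → Fin m), Tendsto (fun N => ν N (cyl w)) atTop (𝓝 (μ (cyl w))))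
    (O : Set ((ℕ → Fin m) × (ℕ → Fin m))) (hO : IsOpen O) :
    (μ.prod μ) O ≤ liminf (fun N => ((ν N).prod (ν N)) O) atTop := by
  have e := (RK_mono O).measure_iUnion (μ := μ.prod μ)
  rw [RK_union O hO] at e
  rw [e]
  refine iSup_le fun K => ?_
  have t : Tendsto (fun N => ((ν N).prod (ν N)) (RK O K)) atTop (𝓝 ((μ.prod μ) (RK O K))) := by
    simp only [RK_meas]
    refine tendsto_finset_sum _ fun x _ => ?_
    exact ENNReal.Tendsto.mul (h K x.1) (Or.inr (measure_ne_top _ _)) (h K x.2) (Or.inr (measure_ne_top _ _))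
  rw [← t.liminf_eq]
  refine liminf_le_liminf (Eventually.of_forall fun N => measure_mono ?_)
  conv_rhs => rw [← RK_union O hO]
  exact Set.subset_iUnion _ _

end absm

section pic
variable {d m : ℕ} {σm σp : ℝ}
lemma cont_pi (h0 : 0 < σm) (h01 : σm < σp) (h2 : σp < 1) (a : Fin m → E d) (ω : Omega d m σm σp) :
    Continuous (piMap a ω) := by
  unfold piMap
  refine continuous_tsum (u := fun n => σp ^ n * ∑ j, ‖a j‖) (fun n => ?_) ?_ ?_
  · have : IsLocallyConstant (fun i : ℕ → Fin m => cumT ω i n (a (i n))) := by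
      rw [IsLocallyConstant.iff_exists_open]
      intro i
      refine ⟨cyl (fun t : Fin (n+1) => i t), (isClopen_cyl _).isOpen, fun t => rfl, fun j hj => ?_⟩
      have hn : j n = i n := hj ⟨n, by omega⟩
      rw [cumT_congr ω ω j i n fun k hk => congrArg ω ((pre_eq_iff j i k).2 fun t ht => hj ⟨t, by omega⟩), hn]
    exact this.continuous
  · exact (summable_geometric_of_lt_one (h0.trans h01).le h2).mul_right _
  · intro n i
    rw [norm_cumT h0]
    have := (h0.trans h01).le
    exact mul_le_mul (cumR_le h0 ω i n) (aBound a _) (norm_nonneg _) (by positivity)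
end pic

section ac
variable {d : ℕ}

lemma ac_of_liminf (ν : Measure (E d)) [IsFiniteMeasure ν] (ρ : ℕ → ℝ) (hρ : ∀ n, 0 < ρ n)
    (hρ0 : Tendsto ρ atTop (𝓝 0))
    (h : liminf (fun n => (ENNReal.ofReal (ρ n) ^ d)⁻¹ * (ν.prod ν) {q | ‖q.1 - q.2‖ < ρ n}) atTop < ⊤) :
    ν ≪ volume := by
  have hO : ∀ n, MeasurableSet {q : E d × E d | ‖q.1 - q.2‖ < ρ n} := fun n =>
    (isOpen_lt (by fun_prop) continuous_const).measurableSet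
  have hf : ∀ n, Measurable fun x : E d => (ENNReal.ofReal (ρ n) ^ d)⁻¹ * ν (Prod.mk x ⁻¹' {q : E d × E d | ‖q.1 - q.2‖ < ρ n}) :=
    fun n => (measurable_measure_prodMk_left (hO n)).const_mul _
  have key : ∫⁻ x, liminf (fun n => (ENNReal.ofReal (ρ n) ^ d)⁻¹ * ν (Prod.mk x ⁻¹' {q : E d × E d | ‖q.1 - q.2‖ < ρ n})) atTop ∂ν < ⊤ := by
    refine (lintegral_liminf_le hf).trans_lt ?_
    refine lt_of_eq_of_lt ?_ h
    congr 1
    funext n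
    rw [lintegral_const_mul _ (measurable_measure_prodMk_left (hO n)), Measure.prod_apply (hO n)]
  have fin := ae_lt_top (Measurable.liminf hf) key.ne
  have bes := Besicovitch.ae_tendsto_rnDeriv (volume : Measure (E d)) ν
  have pos : ∀ᵐ x ∂ν, (volume : Measure (E d)).rnDeriv ν x ≠ 0 := by
    filter_upwards [fin, bes] with x hx hb h0
    rw [h0] at hb
    have hr : Tendsto (fun n => ρ n / 2) atTop (𝓝[>] 0) := by
      refine tendsto_nhdsWithin_iff.2 ⟨by simpa using hρ0.div_const 2, Eventually.of_forall fun n => half_pos (hρ n)⟩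
    have hb' := hb.comp hr
    obtain ⟨B, hB1, hB2⟩ := ENNReal.lt_iff_exists_nnreal_btwn.1 hx
    have fr := Filter.frequently_lt_of_liminf_lt (by isBoundedDefault) hB1
    -- constant
    let c : ℝ≥0∞ := volume (Metric.ball (0 : E d) 1)
    have hc : c ≠ 0 := (Metric.measure_ball_pos _ _ one_pos).ne'
    have hct : c ≠ ⊤ := measure_ball_lt_top.ne
    let ε : ℝ≥0∞ := ENNReal.ofReal (1/2) ^ d * c / (B + 1)
    have hε : 0 < ε := by
      refine ENNReal.div_pos (mul_ne_zero (pow_ne_zero _ (by simp)) hc) (by simp)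
    have ev := hb'.eventually (gt_mem_nhds hε)
    obtain ⟨n, hn1, hn2⟩ := (fr.and_eventually ev).exists
    simp only [Function.comp] at hn2
    have vol : volume (Metric.closedBall x (ρ n / 2)) = ENNReal.ofReal (ρ n) ^ d * (ENNReal.ofReal (1/2) ^ d * c) := by
      rw [Measure.addHaar_closedBall _ _ (half_pos (hρ n)).le]
      simp only [finrank_euclideanSpace, Fintype.card_fin]
      rw [div_eq_mul_one_div, mul_pow, ENNReal.ofReal_mul (by have := hρ n; positivity), ENNReal.ofReal_pow (hρ n).le,
        ENNReal.ofReal_pow (by norm_num), mul_assoc]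
    have sub : ν (Metric.closedBall x (ρ n / 2)) ≤ ν (Prod.mk x ⁻¹' {q : E d × E d | ‖q.1 - q.2‖ < ρ n}) := by
      refine measure_mono fun y hy => ?_
      have : dist y x ≤ ρ n / 2 := hy
      rw [dist_comm, dist_eq_norm] at this
      have := hρ n
      show ‖x - y‖ < ρ n
      linarith
    have hp0 : ENNReal.ofReal (ρ n) ^ d ≠ 0 := pow_ne_zero _ (by simpa using hρ n)
    have hpt : ENNReal.ofReal (ρ n) ^ d ≠ ⊤ := ENNReal.pow_ne_top ENNReal.ofReal_ne_top
    have hν : ν (Metric.closedBall x (ρ n / 2)) ≤ ENNReal.ofReal (ρ n) ^ d * (B + 1) := by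
      refine sub.trans ?_
      have : ν (Prod.mk x ⁻¹' {q : E d × E d | ‖q.1 - q.2‖ < ρ n}) = ENNReal.ofReal (ρ n) ^ d * ((ENNReal.ofReal (ρ n) ^ d)⁻¹ * ν (Prod.mk x ⁻¹' {q : E d × E d | ‖q.1 - q.2‖ < ρ n})) := by
        rw [← mul_assoc, ENNReal.mul_inv_cancel hp0 hpt, one_mul]
      rw [this]
      gcongr
      exact hn1.le.trans le_self_add
    refine absurd hn2 (not_lt.2 ?_)
    rw [vol]
    calc ε = ENNReal.ofReal (ρ n) ^ d * (ENNReal.ofReal (1/2) ^ d * c) / (ENNReal.ofReal (ρ n) ^ d * (B + 1)) := by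
          rw [ENNReal.mul_div_mul_left _ _ hp0 hpt]
      _ ≤ _ := ENNReal.div_le_div_left hν _
  have h1 : ν ≪ ν.withDensity ((volume : Measure (E d)).rnDeriv ν) :=
    withDensity_absolutelyContinuous' (Measure.measurable_rnDeriv _ _).aemeasurable pos
  exact h1.trans (Measure.absolutelyContinuous_of_le (Measure.withDensity_rnDeriv_le _ _))
end ac

section fin
variable {d m : ℕ} {σm σp : ℝ}

noncomputable def nuN (s : ℝ) (β : Measure (ℕ → Fin m)) (ω : Omega d m σm σp) (N : ℕ) : Measure (ℕ → Fin m) :=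
  β.withDensity (fun i => DE s 0 N ω i)

lemma meas_DE1 (s : ℝ) (k N : ℕ) (ω : Omega d m σm σp) : Measurable fun i : ℕ → Fin m => DE s k N ω i :=
  Measurable.comp (g := fun p : Omega d m σm σp × (ℕ → Fin m) => DE s k N p.1 p.2) (f := fun i => (ω, i)) (meas_DE s k N) 
    (measurable_const.prodMk measurable_id)

lemma nuN_apply (hm : 2 ≤ m) (h0 : 0 < σm) (h2 : σp < 1) {s : ℝ} (hs : 0 < s) (β : Measure (ℕ → Fin m)) [IsProbabilityMeasure β]
    (ω : Omega d m σm σp) (N : ℕ) (V : Set (ℕ → Fin m)) (hV : MeasurableSet V) :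
    nuN s β ω N V = ENNReal.ofReal (∫ i in V, DR s 0 N ω i ∂β) := by
  rw [nuN, withDensity_apply _ hV, ofReal_integral_eq_lintegral_ofReal (int_DR hm h0 h2 hs β 0 N ω).integrableOn
    (Eventually.of_forall fun i => DR_nonneg hm h0 s 0 N ω i)]
  simp only [ofReal_DR hm h0]

lemma nuN_fin (hm : 2 ≤ m) (h0 : 0 < σm) (h2 : σp < 1) {s : ℝ} (hs : 0 < s) (β : Measure (ℕ → Fin m)) [IsProbabilityMeasure β]
    (ω : Omega d m σm σp) (N : ℕ) : IsFiniteMeasure (nuN s β ω N) :=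
  ⟨by rw [nuN_apply hm h0 h2 hs β ω N _ MeasurableSet.univ]; exact ENNReal.ofReal_lt_top⟩

lemma meas_nuN (s : ℝ) (β : Measure (ℕ → Fin m)) [IsProbabilityMeasure β] (N : ℕ) (V : Set (ℕ → Fin m)) (hV : MeasurableSet V) :
    Measurable fun ω : Omega d m σm σp => nuN s β ω N V := by
  have : ∀ ω : Omega d m σm σp, nuN s β ω N V = ∫⁻ i, DE s 0 N ω i ∂(β.restrict V) := fun ω => by
    rw [nuN, withDensity_apply _ hV]
  simp only [this]
  exact Measurable.lintegral_prod_right' (f := fun p : Omega d m σm σp × (ℕ → Fin m) => DE s 0 N p.1 p.2) (meas_DE s 0 N)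

lemma nuN_prod (h0 : 0 < σm) (h01 : σm < σp) (h2 : σp < 1) (a : Fin m → E d) (s : ℝ) (β : Measure (ℕ → Fin m)) [IsProbabilityMeasure β]
    (ω : Omega d m σm σp) (N : ℕ) (ρ : ℝ) :
    ((nuN s β ω N).prod (nuN s β ω N)) {q | ‖piMap a ω q.1 - piMap a ω q.2‖ < ρ} = ∫⁻ q, FF a s N ρ (ω, q) ∂(β.prod β) := by
  have hO : MeasurableSet {q : (ℕ → Fin m) × (ℕ → Fin m) | ‖piMap a ω q.1 - piMap a ω q.2‖ < ρ} := by
    have := cont_pi h0 h01 h2 a ω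
    exact (isOpen_lt (by fun_prop) continuous_const).measurableSet
  unfold nuN
  rw [prod_withDensity (meas_DE1 s 0 N ω) (meas_DE1 s 0 N ω), withDensity_apply _ hO, ← lintegral_indicator hO]
  refine lintegral_congr fun q => ?_
  unfold FF
  by_cases hq : ‖piMap a ω q.1 - piMap a ω q.2‖ < ρ <;> simp [Set.indicator, hq]

def Good (s : ℝ) (β : Measure (ℕ → Fin m)) : Set (Omega d m σm σp) :=
  {ω | ∀ k (w : Fin k → Fin m), liminf (fun N => nuN s β ω N (cyl w)) atTop = limsup (fun N => nuN s β ω N (cyl w)) atTop ∧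
    limsup (fun N => nuN s β ω N (cyl w)) atTop < ⊤}

lemma meas_Good (s : ℝ) (β : Measure (ℕ → Fin m)) [IsProbabilityMeasure β] :
    MeasurableSet (Good (d := d) (σm := σm) (σp := σp) s β) := by
  unfold Good
  simp only [Set.setOf_forall]
  refine MeasurableSet.iInter fun k => MeasurableSet.iInter fun w => ?_
  have h1 : Measurable fun ω : Omega d m σm σp => liminf (fun N => nuN s β ω N (cyl w)) atTop :=
    Measurable.liminf fun N => meas_nuN s β N _ (meas_cyl w)
  have h2 : Measurable fun ω : Omega d m σm σp => limsup (fun N => nuN s β ω N (cyl w)) atTop :=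
    Measurable.limsup fun N => meas_nuN s β N _ (meas_cyl w)
  exact (measurableSet_eq_fun h1 h2).inter (measurableSet_lt h2 measurable_const)

lemma Good_tendsto (s : ℝ) (β : Measure (ℕ → Fin m)) (ω : Omega d m σm σp) (hω : ω ∈ Good s β) (k) (w : Fin k → Fin m) :
    Tendsto (fun N => nuN s β ω N (cyl w)) atTop (𝓝 (limsup (fun N => nuN s β ω N (cyl w)) atTop)) :=
  tendsto_of_liminf_eq_limsup (hω k w).1 rfl

lemma main_thm (hd : 1 ≤ d) (hm : 2 ≤ m) (h0 : 0 < σm) (h01 : σm < σp) (h2 : σp < 1)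
    (a : Fin m → E d) (ha : Function.Injective a)
    (θ : Measure (Od d)) [IsProbabilityMeasure θ] [θ.IsMulLeftInvariant]
    (P : Measure (Omega d m σm σp)) [IsProbabilityMeasure P] (hP : IsProductLaw θ P) {s : ℝ} (hs0 : 0 < s)
    (hs : ((m : ℝ) / (σp - σm)) * (∫ r in σm..σp, r ^ s) = 1) (hsd : (d:ℝ) < s) :
    ∃ μ : Omega d m σm σp → Measure (ℕ → Fin m),
      (∀ ω, IsFiniteMeasure (μ ω)) ∧
      (∀ (k : ℕ) (w : Fin k → Fin m), Measurable fun ω => μ ω (cyl w)) ∧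
      (∀ᵐ ω ∂P, 0 < μ ω Set.univ ∧ μ ω Set.univ < ⊤) ∧
      ∀ᵐ ω ∂P, (μ ω).map (piMap a ω) ≪ (volume : Measure (E d)) := by
  classical
  obtain ⟨β, hβ1, hβ⟩ := exists_beta hm
  have ex : ∀ ω : Omega d m σm σp, ω ∈ Good s β → ∃ μ : Measure (ℕ → Fin m), IsFiniteMeasure μ ∧
      ∀ k (w : Fin k → Fin m), μ (cyl w) = limsup (fun N => nuN s β ω N (cyl w)) atTop := fun ω hω =>
    exists_limit hm (nuN s β ω) (nuN_fin hm h0 h2 hs0 β ω) (fun k w => limsup (fun N => nuN s β ω N (cyl w)) atTop)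
      (fun k w => (hω k w).2.ne) (fun k w => Good_tendsto s β ω hω k w)
  choose! M M1 M2 using ex
  have hgood : ∀ᵐ ω ∂P, ω ∈ Good s β := by
    have : ∀ᵐ ω ∂P, ∀ k (w : Fin k → Fin m), ∃ L : ℝ, Tendsto (fun N => ∫ i in cyl w, DR s 0 N ω i ∂β) atTop (𝓝 L) :=
      ae_all_iff.2 fun k => ae_all_iff.2 fun w => conv_ae hm h0 h01 h2 θ P hP hs0 hs β hβ _ (meas_cyl w)
    filter_upwards [this] with ω hω k w
    obtain ⟨L, hL⟩ := hω k w
    have t : Tendsto (fun N => nuN s β ω N (cyl w)) atTop (𝓝 (ENNReal.ofReal L)) := by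
      simp only [nuN_apply hm h0 h2 hs0 β ω _ _ (meas_cyl w)]
      exact ENNReal.tendsto_ofReal hL
    exact ⟨t.liminf_eq.trans t.limsup_eq.symm, by rw [t.limsup_eq]; exact ENNReal.ofReal_lt_top⟩
  refine ⟨fun ω => if ω ∈ Good s β then M ω else 0, fun ω => ?_, fun k w => ?_, ?_, ?_⟩
  · show IsFiniteMeasure (if ω ∈ Good s β then M ω else 0)
    split_ifs with h
    · exact M1 ω h
    · infer_instance
  · have : (fun ω => (if ω ∈ Good s β then M ω else 0) (cyl w)) =
        (Good s β).indicator (fun ω : Omega d m σm σp => limsup (fun N => nuN s β ω N (cyl w)) atTop) := by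
      funext ω
      by_cases h : ω ∈ Good s β
      · simp [h, M2 ω h]
      · simp [h]
    rw [this]
    exact (Measurable.limsup fun N => meas_nuN s β N _ (meas_cyl w)).indicator (meas_Good s β)
  · filter_upwards [hgood, pos_ae hm h0 h01 h2 θ P hP hs0 hs β hβ] with ω hω hp
    haveI := M1 ω hω
    simp only [hω, if_true]
    refine ⟨?_, measure_lt_top _ _⟩
    obtain ⟨c, hc, k, hk⟩ := hp
    have hu : cyl (Fin.elim0 : Fin 0 → Fin m) = Set.univ := by ext j; simp [cyl]
    rw [← hu, M2 ω hω]
    have t := Good_tendsto s β ω hω 0 Fin.elim0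
    refine (ENNReal.ofReal_pos.2 hc).trans_le (ge_of_tendsto t ?_)
    filter_upwards [eventually_ge_atTop k] with N hN
    rw [nuN_apply hm h0 h2 hs0 β ω N _ (meas_cyl _), hu, setIntegral_univ]
    exact ENNReal.ofReal_le_ofReal (hk N hN)
  · obtain ⟨C, hC, hE⟩ := energy hd hm h0 h01 h2 θ P hP hsd hs a ha β hβ
    let ρ : ℕ → ℝ := fun n => 1 / ((n : ℝ) + 1)
    have hρ : ∀ n, 0 < ρ n := fun n => by positivity
    have hρ0 : Tendsto ρ atTop (𝓝 0) := tendsto_one_div_add_atTop_nhds_zero_nat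
    have mI : ∀ N n, Measurable fun ω : Omega d m σm σp => ∫⁻ q, FF a s N (ρ n) (ω, q) ∂(β.prod β) := fun N n =>
      Measurable.lintegral_prod_right' (f := FF a s N (ρ n)) (meas_FF h0 h01 h2 a s N (ρ n))
    have mL : ∀ n, Measurable fun ω : Omega d m σm σp => liminf (fun N => ∫⁻ q, FF a s N (ρ n) (ω, q) ∂(β.prod β)) atTop := fun n =>
      Measurable.liminf fun N => mI N n
    have e1 : ∀ n, ∫⁻ ω, liminf (fun N => ∫⁻ q, FF a s N (ρ n) (ω, q) ∂(β.prod β)) atTop ∂P ≤ C * ENNReal.ofReal (ρ n) ^ d := by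
      intro n
      refine (lintegral_liminf_le fun N => mI N n).trans ?_
      refine (liminf_le_liminf (Eventually.of_forall fun N => hE N (ρ n) (hρ n))).trans ?_
      have hlt : ENNReal.ofReal (σp ^ s) < 1 := by
        rw [ENNReal.ofReal_lt_one]
        exact Real.rpow_lt_one (h0.trans h01).le h2 hs0
      have t : Tendsto (fun N => C * ENNReal.ofReal (ρ n) ^ d + ENNReal.ofReal (σp ^ s) ^ N) atTop (𝓝 (C * ENNReal.ofReal (ρ n) ^ d + 0)) :=
        tendsto_const_nhds.add (ENNReal.tendsto_pow_atTop_nhds_zero_of_lt_one hlt)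
      rw [t.liminf_eq, add_zero]
    have mf : ∀ n, Measurable fun ω : Omega d m σm σp => (ENNReal.ofReal (ρ n) ^ d)⁻¹ * liminf (fun N => ∫⁻ q, FF a s N (ρ n) (ω, q) ∂(β.prod β)) atTop :=
      fun n => (mL n).const_mul _
    have e2 : ∫⁻ ω, liminf (fun n => (ENNReal.ofReal (ρ n) ^ d)⁻¹ * liminf (fun N => ∫⁻ q, FF a s N (ρ n) (ω, q) ∂(β.prod β)) atTop) atTop ∂P ≤ C := by
      refine (lintegral_liminf_le mf).trans ?_
      refine (liminf_le_liminf (v := fun _ => C) (Eventually.of_forall fun n => ?_)).trans (by simp)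
      show ∫⁻ ω, (ENNReal.ofReal (ρ n) ^ d)⁻¹ * liminf (fun N => ∫⁻ q, FF a s N (ρ n) (ω, q) ∂(β.prod β)) atTop ∂P ≤ C
      rw [lintegral_const_mul _ (mL n)]
      have hp0 : ENNReal.ofReal (ρ n) ^ d ≠ 0 := pow_ne_zero _ (by simpa using hρ n)
      have hpt : ENNReal.ofReal (ρ n) ^ d ≠ ⊤ := ENNReal.pow_ne_top ENNReal.ofReal_ne_top
      calc _ ≤ (ENNReal.ofReal (ρ n) ^ d)⁻¹ * (C * ENNReal.ofReal (ρ n) ^ d) := by gcongr; exact e1 n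
        _ = C := by rw [mul_comm C, ← mul_assoc, ENNReal.inv_mul_cancel hp0 hpt, one_mul]
    have fin := ae_lt_top (Measurable.liminf mf) (e2.trans_lt hC.lt_top).ne
    filter_upwards [hgood, fin] with ω hω hf
    haveI := M1 ω hω
    simp only [hω, if_true]
    have hc := cont_pi h0 h01 h2 a ω
    refine ac_of_liminf _ ρ hρ hρ0 (lt_of_le_of_lt ?_ hf)
    refine liminf_le_liminf (Eventually.of_forall fun n => ?_)
    gcongr
    have hO : MeasurableSet {q : E d × E d | ‖q.1 - q.2‖ < ρ n} :=
      (isOpen_lt (by fun_prop) continuous_const).measurableSet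
    rw [Measure.map_prod_map _ _ hc.measurable hc.measurable, Measure.map_apply (hc.measurable.prodMap hc.measurable) hO]
    have hO2 : IsOpen {q : (ℕ → Fin m) × (ℕ → Fin m) | ‖piMap a ω q.1 - piMap a ω q.2‖ < ρ n} :=
      isOpen_lt (by fun_prop) continuous_const
    have := lsc (nuN s β ω) (nuN_fin hm h0 h2 hs0 β ω) (M ω) (fun k w => by
      rw [M2 ω hω]; exact Good_tendsto s β ω hω k w) _ hO2
    simp only [nuN_prod h0 h01 h2] at this
    exact this
end fin

/-- Theorem 4.7 (2): if `s > d` then there are random measures `(μ^ω)` on `J_∞`, with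
measurable cylinder masses and a.s. `0 < μ^ω(J_∞) < ∞`, such that for `ℙ`-a.e. `ω` the
pushforward `π(·,ω)_*μ^ω` is absolutely continuous w.r.t. Lebesgue measure on `ℝ^d`. -/
theorem stmt16 (d m : ℕ) (hd : 1 ≤ d) (hm : 2 ≤ m)
    (σm σp : ℝ) (hσ0 : 0 < σm) (hσ1 : σm ≤ σp) (hσ2 : σp < 1)
    (a : Fin m → E d) (ha : Function.Injective a)
    (θ : Measure (Od d)) (hθ1 : IsProbabilityMeasure θ) (hθ2 : θ.IsMulLeftInvariant)
    (P : Measure (Omega d m σm σp)) (hP1 : IsProbabilityMeasure P)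
    (hP2 : IsProductLaw θ P)
    (s : ℝ) (hs0 : 0 < s)
    (hs : ((m : ℝ) / (σp - σm)) * (∫ r in σm..σp, r ^ s) = 1)
    (hsd : (d : ℝ) < s) :
    ∃ μ : Omega d m σm σp → Measure (ℕ → Fin m),
      (∀ ω, IsFiniteMeasure (μ ω)) ∧
      (∀ (k : ℕ) (w : Fin k → Fin m), Measurable fun ω => μ ω (cyl w)) ∧
      (∀ᵐ ω ∂P, 0 < μ ω Set.univ ∧ μ ω Set.univ < ⊤) ∧
      ∀ᵐ ω ∂P, (μ ω).map (piMap a ω) ≪ (volume : Measure (E d)) := by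
  haveI := hθ1
  haveI := hθ2
  haveI := hP1
  have h01 : σm < σp := by
    rcases hσ1.lt_or_eq with h | h
    · exact h
    · exfalso
      rw [h] at hs
      simp at hs
  exact main_thm hd hm hσ0 h01 hσ2 a ha θ P hP2 hs0 hs hsd
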